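/- arXiv:math/0312505 — 2 statements merged into one kernel-verified Lean document; each statement's English description precedes it below -/
import Mathlib

section
/- Suppose that for the field k and some monomial term order ⪯, the toric ideal I_Λ ⊆ k[z_1,…,z_n] has a quadratic Gröbner basis (a Gröbner basis of degree 2), and assume the α_i are pairwise distinct and each α_i is irreducible in Λ (not the sum of two nonzero elements of Λ). Then each Tor_i^{k[Λ]}(k,k) is a finite-dimensional k-vector space and the Poincaré–Betti series ∑_{i≥0} dim_k Tor_i^{k[Λ]}(k,k) · t^i is a rational power series: there exist polynomials p, q ∈ ℤ[t] with q(0) = 1 such that q · ∑_{i≥0} dim_k Tor_i^{k[Λ]}(k,k) · t^i = p in ℤ[[t]]. -/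
open scoped Classical

noncomputable section

namespace ASG

variable {e n : ℕ}

/-- Ambient monoid `ℕ^e`. -/
abbrev M (e : ℕ) : Type := Fin e →₀ ℕ

/-- The affine semigroup `Λ` generated by `α 1, …, α n`. -/
def sg (α : Fin n → M e) : AddSubmonoid (M e) :=
  AddSubmonoid.closure (Set.range α)

/-- The partial order on `Λ` : `μ ≤ ν` iff `ν - μ ∈ Λ`. -/
def sgLE (α : Fin n → M e) (μ ν : M e) : Prop := ∃ δ ∈ sg α, μ + δ = ν

/-- Strict version of the order on `Λ`. -/
def sgLT (α : Fin n → M e) (μ ν : M e) : Prop := sgLE α μ ν ∧ μ ≠ ν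

/-- `deg λ` : the least `r` such that `λ` is a sum of `r` generators. -/
def deg (α : Fin n → M e) (l : M e) : ℕ :=
  sInf {r : ℕ | ∃ w : Fin r → Fin n, l = ∑ t, α (w t)}

/-- Comparability in the poset `Λ`. -/
def cmp2 (α : Fin n → M e) (a b : M e) : Prop := sgLE α a b ∨ sgLE α b a

/-- Faces of the order complex `Δ(x,y)` of the open interval `(x,y)` in `Λ`:
finite chains of elements strictly between `x` and `y`. -/
def IsOFace (α : Fin n → M e) (x y : M e) (S : Finset (M e)) : Prop :=
  (∀ μ ∈ S, μ ∈ sg α ∧ sgLT α x μ ∧ sgLT α μ y) ∧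
    (S : Set (M e)).Pairwise (cmp2 α)

/-- Faces with `m` vertices (i.e. of dimension `m - 1`). -/
def OFace (α : Fin n → M e) (x y : M e) (m : ℕ) : Type :=
  { S : Finset (M e) // IsOFace α x y S ∧ S.card = m }

/-- The simplicial chain group with coefficients in `K` spanned by the faces
with `m` vertices (the augmented/reduced chain complex: for `m = 0` this is a
copy of `K` spanned by the empty face). -/
abbrev OC (K : Type) [Field K] (α : Fin n → M e) (x y : M e) (m : ℕ) : Type :=
  OFace α x y m →₀ K

/-- Deleting a vertex from a face. -/
def erasedOFace {α : Fin n → M e} {x y : M e} {m : ℕ} (S : OFace α x y m)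
    (v : M e) (hv : v ∈ S.1) : OFace α x y (m - 1) :=
  ⟨S.1.erase v,
    ⟨fun μ hμ => S.2.1.1 μ (Finset.mem_of_mem_erase hμ),
      S.2.1.2.mono (Finset.coe_subset.mpr (Finset.erase_subset _ _))⟩,
    by rw [Finset.card_erase_of_mem hv, S.2.2]⟩

/-- The simplicial boundary map of the (augmented) chain complex of `Δ(x,y)`;
the sign of the deletion of a vertex `v` is `(-1)^(number of vertices below v)`. -/
def obd (K : Type) [Field K] (α : Fin n → M e) (x y : M e) (m : ℕ) :
    OC K α x y m →ₗ[K] OC K α x y (m - 1) :=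
  Finsupp.linearCombination K fun S : OFace α x y m =>
    ∑ v ∈ S.1.attach,
      ((-1 : K) ^ (S.1.filter fun w => sgLT α w v.1).card) •
        Finsupp.single (erasedOFace S v.1 v.2) 1

/-- Vanishing of the reduced simplicial homology `H̃_i(Δ(x,y); K)`, for `i : ℤ`:
every reduced `i`-cycle is a boundary.  (An `i`-dimensional face has `i + 1`
vertices; for `i ≤ -2` the statement is vacuous, as is the reduced homology.) -/
def HredVanishes (K : Type) [Field K] (α : Fin n → M e) (x y : M e) (i : ℤ) : Prop :=
  ∀ m : ℕ, (m : ℤ) = i + 1 →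
    ∀ c : OC K α x y m, obd K α x y m c = 0 →
      ∃ b : OC K α x y (m + 1), obd K α x y (m + 1) b = c

/-- The reduced simplicial homology group `H̃_(m-1)(Δ(x,y); K)` :
cycles in the chain group spanned by faces with `m` vertices modulo boundaries,
realized as the image of the cycles in the cokernel of the boundary map. -/
abbrev HredMod (K : Type) [Field K] (α : Fin n → M e) (x y : M e) (m : ℕ) : Type :=
  ↥(Submodule.map (Submodule.mkQ (LinearMap.range (obd K α x y (m + 1))))
      (LinearMap.ker (obd K α x y m)))

end ASG
namespace ASG

variable {e n : ℕ}

/-- The toric ideal `I_Λ = ker φ ⊆ k[z_1, …, z_n]`, where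
`φ(z_i) = x^(α i) ∈ k[Λ] ⊆ k[x_1, …, x_e]`. -/
def toricIdeal (k : Type) [Field k] (α : Fin n → M e) : Ideal (MvPolynomial (Fin n) k) :=
  RingHom.ker (MvPolynomial.aeval (R := k)
    fun i : Fin n => (MvPolynomial.monomial (α i) 1 : MvPolynomial (Fin e) k))

/-- A monomial term order on `k[z_1, …, z_n]` (monomials identified with their
exponent vectors in `ℕ^n`): a linear order such that `1` is least and which is
compatible with multiplication of monomials. -/
def IsTermOrder (ord : LinearOrder (Fin n →₀ ℕ)) : Prop :=
  (∀ a, ord.le 0 a) ∧ ∀ a b c, ord.le a b → ord.le (a + c) (b + c)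

/-- The initial ideal `in_⪯(I_Λ)`: the ideal generated by the `⪯`-leading
monomials of the nonzero elements of `I_Λ`. -/
def initialIdeal (k : Type) [Field k] (ord : LinearOrder (Fin n →₀ ℕ)) (α : Fin n → M e) :
    Ideal (MvPolynomial (Fin n) k) :=
  Ideal.span {p | ∃ f ∈ toricIdeal k α, f ≠ 0 ∧ ∃ mo : Fin n →₀ ℕ,
    (mo ∈ f.support ∧ ∀ m' ∈ f.support, ord.le m' mo) ∧ p = MvPolynomial.monomial mo 1}

/-- `I_Λ` has a Gröbner basis of degree `d` with respect to `⪯` iff `in_⪯(I_Λ)`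
is generated by monomials of total degree at most `d`. -/
def HasGB (k : Type) [Field k] (ord : LinearOrder (Fin n →₀ ℕ)) (α : Fin n → M e)
    (d : ℕ) : Prop :=
  ∃ G : Set (Fin n →₀ ℕ), (∀ mo ∈ G, (mo.sum fun _ c => c) ≤ d) ∧
    Ideal.span ((fun mo => (MvPolynomial.monomial mo 1 : MvPolynomial (Fin n) k)) '' G)
      = initialIdeal k ord α

end ASG
namespace ASG

variable {e n : ℕ}

/-- Faces of the full normalized bar complex of `K` over `K[Λ]` in chain form:
finite chains in `Λ` starting at `0`. -/
def IsBTFace (α : Fin n → M e) (S : Finset (M e)) : Prop :=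
  (∀ μ ∈ S, μ ∈ sg α) ∧ (0 : M e) ∈ S ∧ (S : Set (M e)).Pairwise (cmp2 α)

def BTFace (α : Fin n → M e) (i : ℕ) : Type :=
  { S : Finset (M e) // IsBTFace α S ∧ S.card = i + 1 }

/-- The normalized bar complex of `K` over `K[Λ]` in homological degree `i`. -/
abbrev TCt (K : Type) [Field K] (α : Fin n → M e) (i : ℕ) : Type :=
  BTFace α i →₀ K

/-- Deleting an internal element (neither `0` nor the top) of a bar chain. -/
def erasedBTFace {α : Fin n → M e} {i : ℕ} (S : BTFace α i)
    (v : M e) (hv : v ∈ S.1) (h0 : v ≠ 0) : BTFace α (i - 1) :=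
  ⟨S.1.erase v,
    ⟨⟨fun μ hμ => S.2.1.1 μ (Finset.mem_of_mem_erase hμ),
      Finset.mem_erase.2 ⟨fun h => h0 h.symm, S.2.1.2.1⟩,
      S.2.1.2.2.mono (Finset.coe_subset.mpr (Finset.erase_subset _ _))⟩,
    by
      have h2 : 1 < S.1.card :=
        Finset.one_lt_card.mpr ⟨0, S.2.1.2.1, v, hv, fun h => h0 h.symm⟩
      have hc := S.2.2
      rw [Finset.card_erase_of_mem hv]
      omega⟩⟩

/-- The differential of the normalized bar complex of `K` over `K[Λ]`:
deletion of internal chain elements, with sign `(-1)^j` for the `j`-th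
element of the chain. -/
def ttbd (K : Type) [Field K] (α : Fin n → M e) (i : ℕ) :
    TCt K α i →ₗ[K] TCt K α (i - 1) :=
  Finsupp.linearCombination K fun S : BTFace α i =>
    ∑ v ∈ S.1.attach,
      if h : v.1 ≠ 0 ∧ ∃ w ∈ S.1, sgLT α v.1 w then
        ((-1 : K) ^ (S.1.filter fun w => sgLT α w v.1).card) •
          Finsupp.single (erasedBTFace S v.1 v.2 h.1) 1
      else 0

/-- `Tor_i^{K[Λ]}(K, K)`, computed from the normalized bar resolution of `K`
over `K[Λ]`, realized as the image of the cycles in the cokernel of the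
differential. -/
abbrev TorTot (K : Type) [Field K] (α : Fin n → M e) (i : ℕ) : Type :=
  ↥(Submodule.map (Submodule.mkQ (LinearMap.range (ttbd K α (i + 1))))
      (LinearMap.ker (ttbd K α i)))

end ASG
namespace ASGP

/-- Data of a perfect algebraic Morse matching. -/
structure MorseData {B k : Type} [Field k] (d : B → B →₀ k) (F : ℕ → Set B) (K : Set B)
    (P : B → B → Prop) (rk : B → ℕ) : Prop where
  hF0 : ∀ b ∈ F 0, d b = 0
  hF : ∀ i, ∀ b ∈ F (i + 1), ∀ c, d b c ≠ 0 → c ∈ F i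
  hdd : ∀ i, ∀ b ∈ F i, Finsupp.linearCombination k d (d b) = 0
  ex : ∀ i, ∀ b ∈ F i, b ∈ K ∨ (∃ τ, P b τ) ∨ ∃ σ, P σ b
  KD : ∀ b ∈ K, ∀ τ, ¬ P b τ
  hK : ∀ i, ∀ b ∈ F i, ∀ c ∈ K, d b c = 0
  Pinj : ∀ σ σ' τ, P σ τ → P σ' τ → σ = σ'
  PF : ∀ i σ τ, P σ τ → τ ∈ F i → σ ∈ F (i + 1)
  Pne : ∀ σ τ, P σ τ → d σ τ ≠ 0
  tri : ∀ σ τ σ' τ', P σ τ → d σ τ' ≠ 0 → P σ' τ' → τ' = τ ∨ rk σ' < rk σ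

namespace MorseData

variable {B k : Type} [Field k] {d : B → B →₀ k} {F : ℕ → Set B} {K : Set B}
    {P : B → B → Prop} {rk : B → ℕ}

lemma lc_apply (x : B →₀ k) (b : B) :
    Finsupp.linearCombination k d x b = ∑ a ∈ x.support, x a * d a b := by
  rw [Finsupp.linearCombination_apply, Finsupp.sum, Finsupp.finsetSum_apply]
  rfl

lemma inj (h : MorseData d F K P rk) (y : B →₀ k) (hy : ∀ σ, y σ ≠ 0 → ∃ τ, P σ τ)
    (hU : ∀ σ τ, P σ τ → Finsupp.linearCombination k d y τ = 0) : y = 0 := by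
  by_contra hne
  have hs : y.support.Nonempty := Finsupp.support_nonempty_iff.2 hne
  obtain ⟨σ, hσ, hmax⟩ := Finset.exists_max_image y.support rk hs
  have hσ0 : y σ ≠ 0 := Finsupp.mem_support_iff.1 hσ
  obtain ⟨τ, hP⟩ := hy σ hσ0
  have h0 := hU σ τ hP
  rw [lc_apply, Finset.sum_eq_single σ] at h0
  · exact mul_ne_zero hσ0 (h.Pne σ τ hP) h0
  · intro σ' hσ' hneq
    by_contra hc
    have hd : d σ' τ ≠ 0 := right_ne_zero_of_mul hc
    obtain ⟨τ1, hP1⟩ := hy σ' (Finsupp.mem_support_iff.1 hσ')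
    rcases h.tri σ' τ1 σ τ hP1 hd hP with e | e
    · subst e; exact hneq (h.Pinj _ _ _ hP1 hP)
    · exact absurd (hmax σ' hσ') (not_le.2 e)
  · intro hh; exact absurd hσ hh

/-- supported on `F i` -/
def Sup (F : ℕ → Set B) (i : ℕ) (x : B →₀ k) : Prop := ∀ b, x b ≠ 0 → b ∈ F i

lemma d_sup (h : MorseData d F K P rk) {i : ℕ} {x : B →₀ k} (hx : Sup F (i + 1) x) :
    Sup F i (Finsupp.linearCombination k d x) := by
  intro b hb
  rw [lc_apply] at hb
  obtain ⟨a, ha, hne⟩ := Finset.exists_ne_zero_of_sum_ne_zero hb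
  exact h.hF i a (hx a (left_ne_zero_of_mul hne)) b (right_ne_zero_of_mul hne)

lemma d_sup0 (h : MorseData d F K P rk) {x : B →₀ k} (hx : Sup F 0 x) :
    Finsupp.linearCombination k d x = 0 := by
  rw [Finsupp.linearCombination_apply, Finsupp.sum]
  refine Finset.sum_eq_zero fun a ha => ?_
  rw [h.hF0 a (hx a (Finsupp.mem_support_iff.1 ha)), smul_zero]

lemma dd (h : MorseData d F K P rk) {i : ℕ} {x : B →₀ k} (hx : Sup F i x) :
    Finsupp.linearCombination k d (Finsupp.linearCombination k d x) = 0 := by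
  conv_lhs => rw [Finsupp.linearCombination_apply k x, Finsupp.sum]
  rw [map_sum]
  refine Finset.sum_eq_zero fun a ha => ?_
  rw [map_smul, h.hdd i a (hx a (Finsupp.mem_support_iff.1 ha)), smul_zero]

lemma dK (h : MorseData d F K P rk) {i : ℕ} {x : B →₀ k} (hx : Sup F i x) {c : B} (hc : c ∈ K) :
    Finsupp.linearCombination k d x c = 0 := by
  rw [lc_apply]
  refine Finset.sum_eq_zero fun a ha => ?_
  rw [h.hK i a (hx a (Finsupp.mem_support_iff.1 ha)) c hc, mul_zero]

/-- The `y` part supported on `D`-cells of degree `i+1`. -/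
def Good (F : ℕ → Set B) (P : B → B → Prop) (i : ℕ) (y : B →₀ k) : Prop :=
  Sup F i y ∧ ∀ σ, y σ ≠ 0 → ∃ τ, P σ τ

lemma good_add {i : ℕ} {x y : B →₀ k} (hx : Good F P i x) (hy : Good F P i y) :
    Good F P i (x + y) := by
  have key : ∀ b, (x + y) b ≠ 0 → x b ≠ 0 ∨ y b ≠ 0 := by
    intro b hb
    by_contra! hc
    exact hb (by simp [hc.1, hc.2])
  exact ⟨fun b hb => (key b hb).elim (hx.1 b) (hy.1 b),
    fun b hb => (key b hb).elim (hx.2 b) (hy.2 b)⟩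

lemma good_smul {i : ℕ} {x : B →₀ k} (r : k) (hx : Good F P i x) : Good F P i (r • x) := by
  have key : ∀ b, (r • x) b ≠ 0 → x b ≠ 0 := by
    intro b hb hc
    exact hb (by simp [hc])
  exact ⟨fun b hb => hx.1 b (key b hb), fun b hb => hx.2 b (key b hb)⟩

lemma good_zero {i : ℕ} : Good F P i (0 : B →₀ k) :=
  ⟨fun _ hb => absurd rfl hb, fun _ hb => absurd rfl hb⟩

lemma good_sum {ι : Type} {i : ℕ} (s : Finset ι) (f : ι → B →₀ k)
    (hf : ∀ a ∈ s, Good F P i (f a)) : Good F P i (∑ a ∈ s, f a) := by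
  classical
  induction s using Finset.induction_on with
  | empty => simpa using good_zero
  | insert a s ha ih =>
    rw [Finset.sum_insert ha]
    exact good_add (hf a (by simp)) (ih fun b hb => hf b (by simp [hb]))

lemma surj_single (h : MorseData d F K P rk) (i : ℕ) : ∀ (N : ℕ) (σ τ : B), rk σ < N → P σ τ →
    τ ∈ F i → ∃ y : B →₀ k, Good F P (i + 1) y ∧
      ∀ σ' τ', P σ' τ' → Finsupp.linearCombination k d y τ' = Finsupp.single τ (1 : k) τ' := by
  classical
  intro N
  induction N with
  | zero => intro σ τ h0; omega
  | succ N ih =>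
    intro σ τ hr hP hτ
    have hσF := h.PF i σ τ hP hτ
    -- other faces
    have hch : ∀ τ' : B, ∃ y : B →₀ k, Good F P (i + 1) y ∧
        ((τ' ≠ τ ∧ d σ τ' ≠ 0) →
        ∀ σ' τ'', P σ' τ'' → Finsupp.linearCombination k d y τ'' = Finsupp.single τ' (1 : k) τ'') := by
      intro τ'
      by_cases hc : τ' ≠ τ ∧ d σ τ' ≠ 0 ∧ ∃ σ', P σ' τ'
      · obtain ⟨h1, h2, σ', h3⟩ := hc
        have hlt : rk σ' < rk σ := (h.tri σ τ σ' τ' hP h2 h3).resolve_left h1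
        obtain ⟨y, hy, hy2⟩ := ih σ' τ' (by omega) h3 (h.hF i σ hσF τ' h2)
        exact ⟨y, hy, fun _ => hy2⟩
      · refine ⟨0, good_zero, fun hh σ' τ'' hP' => ?_⟩
        have : τ' ≠ τ'' := by
          rintro rfl
          exact hc ⟨hh.1, hh.2, σ', hP'⟩
        simp [this]
    choose Y hY1 hY2 using hch
    have hne := h.Pne σ τ hP
    refine ⟨(d σ τ)⁻¹ • (Finsupp.single σ 1 +
      ∑ τ' ∈ (d σ).support.erase τ, (-(d σ τ')) • Y τ'), ?_, ?_⟩
    · refine good_smul _ (good_add ⟨?_, ?_⟩ (good_sum _ _ fun a _ => good_smul _ (hY1 a)))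
      · intro b hb
        have : b = σ := by
          by_contra hh
          exact hb (by simp [Ne.symm hh])
        rwa [this]
      · intro b hb
        have : b = σ := by
          by_contra hh
          exact hb (by simp [Ne.symm hh])
        rw [this]; exact ⟨τ, hP⟩
    · intro σ1 τ1 hP1
      have hdσ : d σ τ1 = ∑ τ' ∈ (d σ).support, d σ τ' * Finsupp.single τ' (1 : k) τ1 := by
        have := congrArg (fun f => f τ1) (Finsupp.sum_single (d σ))
        simp only [Finsupp.sum, Finsupp.finsetSum_apply] at this
        rw [← this]
        refine Finset.sum_congr rfl fun a _ => ?_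
        simp [Finsupp.single_apply]
      rw [← Finset.add_sum_erase _ _ (Finsupp.mem_support_iff.2 hne)] at hdσ
      have hsum : ∑ τ' ∈ (d σ).support.erase τ, (-(d σ τ')) *
          (Finsupp.linearCombination k d (Y τ') τ1) =
          - ∑ τ' ∈ (d σ).support.erase τ, d σ τ' * Finsupp.single τ' (1 : k) τ1 := by
        rw [← Finset.sum_neg_distrib]
        refine Finset.sum_congr rfl fun a ha => ?_
        obtain ⟨ha1, ha2⟩ := Finset.mem_erase.1 ha
        rw [hY2 a ⟨ha1, Finsupp.mem_support_iff.1 ha2⟩ σ1 τ1 hP1, neg_mul]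
      simp only [map_smul, map_add, map_sum, Finsupp.linearCombination_single, one_smul,
        Finsupp.smul_apply, Finsupp.add_apply, Finsupp.finsetSum_apply, smul_eq_mul]
      rw [hsum, hdσ]
      field_simp
      ring

lemma surj (h : MorseData d F K P rk) (i : ℕ) (u : B →₀ k) (hu : Sup F i u) :
    ∃ y : B →₀ k, Good F P (i + 1) y ∧
      ∀ σ' τ', P σ' τ' → Finsupp.linearCombination k d y τ' = u τ' := by
  classical
  have hch : ∀ τ' : B, ∃ y : B →₀ k, Good F P (i + 1) y ∧ (u τ' ≠ 0 →
      ∀ σ' τ'', P σ' τ'' → Finsupp.linearCombination k d y τ'' = Finsupp.single τ' (1 : k) τ'') := by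
    intro τ'
    by_cases hc : u τ' ≠ 0 ∧ ∃ σ', P σ' τ'
    · obtain ⟨h1, σ', h3⟩ := hc
      obtain ⟨y, hy, hy2⟩ := h.surj_single i (rk σ' + 1) σ' τ' (by omega) h3 (hu τ' h1)
      exact ⟨y, hy, fun _ => hy2⟩
    · refine ⟨0, good_zero, fun hh σ' τ'' hP' => ?_⟩
      have : τ' ≠ τ'' := by
        rintro rfl
        exact hc ⟨hh, σ', hP'⟩
      simp [this]
  choose Y hY1 hY2 using hch
  refine ⟨∑ a ∈ u.support, u a • Y a, good_sum _ _ fun a _ => good_smul _ (hY1 a), ?_⟩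
  intro σ1 τ1 hP1
  have hu' : u τ1 = ∑ τ' ∈ u.support, u τ' * Finsupp.single τ' (1 : k) τ1 := by
    have := congrArg (fun f => f τ1) (Finsupp.sum_single u)
    simp only [Finsupp.sum, Finsupp.finsetSum_apply] at this
    rw [← this]
    refine Finset.sum_congr rfl fun a _ => ?_
    simp [Finsupp.single_apply]
  rw [hu']
  simp only [map_smul, map_sum, Finsupp.smul_apply, Finsupp.finsetSum_apply, smul_eq_mul]
  refine Finset.sum_congr rfl fun a ha => ?_
  rw [hY2 a (Finsupp.mem_support_iff.1 ha) σ1 τ1 hP1]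

lemma eq_zero_of (h : MorseData d F K P rk) (i : ℕ) (c : B →₀ k) (hc : Sup F i c)
    (hd : Finsupp.linearCombination k d c = 0) (hK : ∀ b ∈ K, c b = 0)
    (hU : ∀ σ τ, P σ τ → c τ = 0) : c = 0 := by
  refine h.inj c ?_ ?_
  · intro σ hσ
    rcases h.ex i σ (hc σ hσ) with h1 | h1 | ⟨σ', h1⟩
    · exact absurd (hK σ h1) hσ
    · exact h1
    · exact absurd (hU _ _ h1) hσ
  · intro σ τ _
    rw [hd]; rfl

theorem homology_inj (h : MorseData d F K P rk) (i : ℕ) (c : B →₀ k) (hc : Sup F i c)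
    (hd : Finsupp.linearCombination k d c = 0) (hK : ∀ b ∈ K, c b = 0) :
    ∃ b : B →₀ k, Sup F (i + 1) b ∧ Finsupp.linearCombination k d b = c := by
  obtain ⟨y, hy, hyU⟩ := h.surj i c hc
  refine ⟨y, hy.1, ?_⟩
  have hsub : Finsupp.linearCombination k d y - c = 0 := by
    refine h.eq_zero_of i _ ?_ ?_ ?_ ?_
    · intro b hb
      by_cases hcb : c b = 0
      · exact h.d_sup hy.1 b (by simpa [hcb] using hb)
      · exact hc b hcb
    · rw [map_sub, h.dd hy.1, hd, sub_zero]
    · intro b hb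
      rw [Finsupp.sub_apply, h.dK hy.1 hb, hK b hb, sub_zero]
    · intro σ τ hP
      rw [Finsupp.sub_apply, hyU σ τ hP, sub_self]
  exact sub_eq_zero.1 hsub

theorem homology_surj (h : MorseData d F K P rk) (i : ℕ) (x : B →₀ k) (hx : Sup F i x) :
    ∃ c : B →₀ k, Sup F i c ∧ Finsupp.linearCombination k d c = 0 ∧ ∀ b ∈ K, c b = x b := by
  cases i with
  | zero => exact ⟨x, hx, h.d_sup0 hx, fun _ _ => rfl⟩
  | succ i =>
    obtain ⟨y, hy, hyU⟩ := h.surj i _ (h.d_sup hx)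
    have hS : Sup F (i + 1) (x - y) := by
      intro b hb
      by_cases hcb : x b = 0
      · exact hy.1 b (by simpa [hcb] using hb)
      · exact hx b hcb
    refine ⟨x - y, hS, ?_, ?_⟩
    · refine h.eq_zero_of i _ (h.d_sup hS) (h.dd hS) (fun b hb => h.dK hS hb) ?_
      intro σ τ hP
      rw [map_sub, Finsupp.sub_apply, hyU σ τ hP, sub_self]
    · intro b hb
      have : y b = 0 := by
        by_contra hne
        obtain ⟨τ, hP⟩ := hy.2 b hne
        exact h.KD b hb τ hP
      rw [Finsupp.sub_apply, this, sub_zero]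

end MorseData
end ASGP
namespace ASGP
open ASG

/-- Normal form data for the semigroup. -/
structure NF {e n : ℕ} (α : Fin n → M e) where
  nf : M e → (Fin n →₀ ℕ)
  lt : (Fin n →₀ ℕ) → (Fin n →₀ ℕ) → Prop
  cm : Fin n → Fin n → Prop
  lt_irrefl : ∀ a, ¬ lt a a
  lt_trans : ∀ a b c, lt a b → lt b c → lt a c
  lt_add : ∀ a b c, lt a b → lt (a + c) (b + c)
  nf_gen : ∀ c, nf (α c) = Finsupp.single c 1
  nf_split : ∀ μ ∈ sg α, ∀ c, nf μ c ≠ 0 → ∃ ν ∈ sg α, μ = α c + ν ∧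
    nf μ = Finsupp.single c 1 + nf ν ∧ ∀ d, nf ν d ≠ 0 → cm c d
  nf_join : ∀ ν ∈ sg α, ∀ c, (∀ d, nf ν d ≠ 0 → cm c d) → nf (α c + ν) = Finsupp.single c 1 + nf ν
  nf_le : ∀ μ ∈ sg α, ∀ ν ∈ sg α, nf (μ + ν) = nf μ + nf ν ∨ lt (nf (μ + ν)) (nf μ + nf ν)
  nf_cm : ∀ c d, nf (α c + α d) = nf (α c) + nf (α d) → cm c d
  nf_ne : ∀ μ ∈ sg α, μ ≠ 0 → ∃ c, nf μ c ≠ 0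
  a_ne : ∀ i, α i ≠ 0
  a_inj : Function.Injective α
  a_irr : ∀ i, ¬ ∃ a ∈ sg α, ∃ b ∈ sg α, a ≠ 0 ∧ b ≠ 0 ∧ a + b = α i

namespace NF

variable {e n : ℕ} {α : Fin n → M e} (H : NF α)

lemma gen_mem (α : Fin n → M e) (c : Fin n) : α c ∈ sg α :=
  AddSubmonoid.subset_closure ⟨c, rfl⟩

lemma irr {e n : ℕ} {α : Fin n → M e} (H : NF α) {c i : Fin n} {m : M e} (hm : m ∈ sg α) (h0 : m ≠ 0) : α c + m ≠ α i :=
  fun h => H.a_irr i ⟨α c, gen_mem α c, m, hm, H.a_ne c, h0, h⟩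

def next (Q : Finset (Fin n)) (c : Fin n) : Finset (Fin n) :=
  Finset.univ.filter fun d => ¬ H.cm c d ∨ (d ∈ Q ∧ c < d)

lemma mem_next {Q : Finset (Fin n)} {c d : Fin n} :
    d ∈ H.next Q c ↔ ¬ H.cm c d ∨ (d ∈ Q ∧ c < d) := by simp [next]

/-- all entries nonzero elements of the semigroup -/
def Gd (α : Fin n → M e) (l : List (M e)) : Prop := ∀ m ∈ l, m ∈ sg α ∧ m ≠ 0

lemma gd_cons {m : M e} {l : List (M e)} : Gd α (m :: l) ↔ (m ∈ sg α ∧ m ≠ 0) ∧ Gd α l := by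
  simp [Gd]

inductive Crit : Finset (Fin n) → List (M e) → Prop
  | nil (Q : Finset (Fin n)) : Crit Q []
  | cons (Q : Finset (Fin n)) (c : Fin n) (l : List (M e)) : c ∈ Q → Crit (H.next Q c) l →
      Crit Q (α c :: l)

inductive Pair : Finset (Fin n) → List (M e) → List (M e) → List (Fin n) → Prop
  | here (Q : Finset (Fin n)) (c : Fin n) (m : M e) (l : List (M e)) : c ∈ Q → m ∈ sg α → m ≠ 0 →
      (∀ d, H.nf m d ≠ 0 → d ∉ H.next Q c) → Pair Q (α c :: m :: l) ((α c + m) :: l) [c]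
  | there (Q : Finset (Fin n)) (c : Fin n) (σ τ : List (M e)) (w : List (Fin n)) : c ∈ Q →
      Pair (H.next Q c) σ τ w → Pair Q (α c :: σ) (α c :: τ) (c :: w)

inductive Face : List (M e) → List (M e) → Prop
  | merge (a b : M e) (l : List (M e)) : Face (a :: b :: l) ((a + b) :: l)
  | cons (a : M e) (l l' : List (M e)) : Face l l' → Face (a :: l) (a :: l')

def tot (l : List (M e)) : Fin n →₀ ℕ := (l.map H.nf).sum

@[simp] lemma tot_cons (m : M e) (l : List (M e)) : H.tot (m :: l) = H.nf m + H.tot l := by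
  simp [tot]

lemma cm_of_not_next {Q : Finset (Fin n)} {c : Fin n} {m : M e}
    (h : ∀ d, H.nf m d ≠ 0 → d ∉ H.next Q c) : ∀ d, H.nf m d ≠ 0 → H.cm c d := by
  intro d hd
  by_contra hc
  exact h d hd (H.mem_next.2 (Or.inl hc))

lemma nf_here {Q : Finset (Fin n)} {c : Fin n} {m : M e} (hm : m ∈ sg α)
    (h : ∀ d, H.nf m d ≠ 0 → d ∉ H.next Q c) :
    H.nf (α c + m) = Finsupp.single c 1 + H.nf m :=
  H.nf_join m hm c (H.cm_of_not_next h)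

/-- characterization of the split letter as a maximum -/
lemma here_max {Q : Finset (Fin n)} {c : Fin n} {m : M e} (hm : m ∈ sg α)
    (h : ∀ d, H.nf m d ≠ 0 → d ∉ H.next Q c) (d : Fin n) (hd : H.nf (α c + m) d ≠ 0)
    (hdQ : d ∈ Q) : d ≤ c := by
  rw [H.nf_here hm h] at hd
  by_cases hcd : d = c
  · exact hcd.le
  · have : H.nf m d ≠ 0 := by
      intro h0
      apply hd
      rw [Finsupp.add_apply, h0, Finsupp.single_apply, if_neg (Ne.symm hcd)]
    by_contra hlt
    exact h d this (H.mem_next.2 (Or.inr ⟨hdQ, not_le.1 hlt⟩))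

lemma here_ne {Q : Finset (Fin n)} {c : Fin n} {m : M e} (hm : m ∈ sg α)
    (h : ∀ d, H.nf m d ≠ 0 → d ∉ H.next Q c) : H.nf (α c + m) c ≠ 0 := by
  rw [H.nf_here hm h]; simp

lemma pair_tot {Q σ τ w} (h : H.Pair Q σ τ w) : H.tot τ = H.tot σ := by
  induction h with
  | here Q c m l hc hm h0 hd => simp [H.nf_here hm hd, H.nf_gen, add_assoc]
  | there Q c σ τ w hc hp ih => simp [ih]

lemma pair_face {Q σ τ w} (h : H.Pair Q σ τ w) : Face σ τ := by
  induction h with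
  | here => exact Face.merge _ _ _
  | there Q c σ τ w hc hp ih => exact Face.cons _ _ _ ih

lemma pair_word {Q σ τ w} (h : H.Pair Q σ τ w) : w ≠ [] := by
  cases h <;> simp

lemma pair_gd {Q σ τ w} (h : H.Pair Q σ τ w) (hg : Gd α τ) : Gd α σ := by
  induction h with
  | here Q c m l hc hm h0 hd =>
    rw [gd_cons] at hg
    rw [gd_cons, gd_cons]
    exact ⟨⟨gen_mem α c, H.a_ne c⟩, ⟨hm, h0⟩, hg.2⟩
  | there Q c σ τ w hc hp ih =>
    rw [gd_cons] at hg ⊢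
    exact ⟨hg.1, ih hg.2⟩

lemma face_tot {σ τ} (h : Face σ τ) (hg : Gd α σ) : H.tot τ = H.tot σ ∨ H.lt (H.tot τ) (H.tot σ) := by
  induction h with
  | merge a b l =>
    rw [gd_cons, gd_cons] at hg
    simp only [tot_cons]
    rcases H.nf_le a hg.1.1 b hg.2.1.1 with h | h
    · left; rw [h, add_assoc]
    · right; rw [← add_assoc]; exact H.lt_add _ _ _ h
  | cons a l l' hf ih =>
    rw [gd_cons] at hg
    simp only [tot_cons]
    rcases ih hg.2 with h | h
    · left; rw [h]
    · right; rw [add_comm, add_comm (H.nf a)]; exact H.lt_add _ _ _ h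

lemma face_sum {σ τ : List (M e)} (h : Face σ τ) : τ.sum = σ.sum := by
  induction h with
  | merge a b l => simp [add_assoc]
  | cons a l l' hf ih => simp [ih]

/-- heads of tops -/
lemma pair_head_σ {Q σ τ w} (h : H.Pair Q σ τ w) : ∃ c l, σ = α c :: l ∧ c ∈ Q := by
  cases h with
  | here _ c m l hc hm h0 hd => exact ⟨c, _, rfl, hc⟩
  | there _ c σ τ w hc hp => exact ⟨c, _, rfl, hc⟩

lemma pair_head_τ {Q τ σ w} (h : H.Pair Q σ τ w) : ∃ m l, τ = m :: l ∧ ∃ c ∈ Q, H.nf m c ≠ 0 := by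
  cases h with
  | here _ c m l hc hm h0 hd => exact ⟨_, _, rfl, c, hc, H.here_ne hm hd⟩
  | there _ c σ τ w hc hp => exact ⟨_, _, rfl, c, hc, by simp [H.nf_gen]⟩

lemma pair_inj {Q σ τ w} (h : H.Pair Q σ τ w) : ∀ {σ' w'}, H.Pair Q σ' τ w' → σ = σ' := by
  induction h with
  | here Q c m l hc hm h0 hd =>
    intro σ' w' h'
    generalize hτ : (α c + m) :: l = τ at h'
    cases h' with
    | here _ c' m' l' hc' hm' h0' hd' =>
      obtain ⟨h1, rfl⟩ := List.cons.inj hτ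
      have hcc : c = c' := by
        apply le_antisymm
        · exact H.here_max hm' hd' c (by rw [← h1]; exact H.here_ne hm hd) hc
        · exact H.here_max hm hd c' (by rw [h1]; exact H.here_ne hm' hd') hc'
      subst hcc
      rw [add_left_cancel h1]
    | there _ c' σ1 τ1 w1 hc' hp' =>
      exact absurd (List.cons.inj hτ).1 (H.irr hm h0)
  | there Q c σ τ w hc hp ih =>
    intro σ' w' h'
    generalize hτ : α c :: τ = τ0 at h'
    cases h' with
    | here _ c' m' l' hc' hm' h0' hd' => exact absurd (List.cons.inj hτ).1.symm (H.irr hm' h0')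
    | there _ c' σ1 τ1 w1 hc' hp' =>
      obtain ⟨h1, rfl⟩ := List.cons.inj hτ
      have := H.a_inj h1
      subst this
      rw [ih hp']

lemma word_unique {Q σ τ w} (h : H.Pair Q σ τ w) : ∀ {τ' w'}, H.Pair Q σ τ' w' → w = w' := by
  induction h with
  | here Q c m l hc hm h0 hd =>
    intro τ' w' h'
    generalize hσ : α c :: m :: l = σ at h'
    cases h' with
    | here _ c' m' l' hc' hm' h0' hd' =>
      rw [H.a_inj (List.cons.inj hσ).1]
    | there _ c' σ1 τ1 w1 hc' hp' =>
      obtain ⟨h1, rfl⟩ := List.cons.inj hσ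
      have := H.a_inj h1
      subst this
      obtain ⟨x, l1, hx, hxQ⟩ := H.pair_head_σ hp'
      exact absurd hxQ (hd x (by rw [(List.cons.inj hx).1, H.nf_gen]; simp))
  | there Q c σ τ w hc hp ih =>
    intro τ' w' h'
    generalize hσ : α c :: σ = σ0 at h'
    cases h' with
    | here _ c' m' l' hc' hm' h0' hd' =>
      obtain ⟨h1, rfl⟩ := List.cons.inj hσ
      have := H.a_inj h1
      subst this
      obtain ⟨x, l1, hx, hxQ⟩ := H.pair_head_σ hp
      exact absurd hxQ (hd' x (by rw [(List.cons.inj hx).1, H.nf_gen]; simp))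
    | there _ c' σ1 τ1 w1 hc' hp' =>
      obtain ⟨h1, rfl⟩ := List.cons.inj hσ
      have := H.a_inj h1
      subst this
      rw [ih hp']

lemma crit_not_pair {Q σ τ w} (h : H.Pair Q σ τ w) : ¬ H.Crit Q σ := by
  induction h with
  | here Q c m l hc hm h0 hd =>
    intro hC
    generalize hσ : α c :: m :: l = σ at hC
    cases hC with
    | nil => simp at hσ
    | cons _ c' l' hc' hC' =>
      obtain ⟨h1, rfl⟩ := List.cons.inj hσ
      have := H.a_inj h1
      subst this
      generalize hσ' : m :: l = σ' at hC'
      cases hC' with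
      | nil => simp at hσ'
      | cons _ c'' l'' hc'' hC'' =>
        obtain ⟨rfl, rfl⟩ := List.cons.inj hσ'
        exact hd c'' (by simp [H.nf_gen]) hc''
  | there Q c σ τ w hc hp ih =>
    intro hC
    generalize hσ : α c :: σ = σ0 at hC
    cases hC with
    | nil => simp at hσ
    | cons _ c' l' hc' hC' =>
      obtain ⟨h1, rfl⟩ := List.cons.inj hσ
      have := H.a_inj h1
      subst this
      exact ih hC'

lemma face_not_crit {σ τ} (h : Face σ τ) (hg : Gd α σ) : ∀ Q, ¬ H.Crit Q τ := by
  induction h with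
  | merge a b l =>
    intro Q hC
    rw [gd_cons, gd_cons] at hg
    generalize hσ : (a + b) :: l = σ at hC
    cases hC with
    | nil => simp at hσ
    | cons _ c' l' hc' hC' =>
      exact H.a_irr c' ⟨a, hg.1.1, b, hg.2.1.1, hg.1.2, hg.2.1.2, (List.cons.inj hσ).1⟩
  | cons a l l' hf ih =>
    intro Q hC
    rw [gd_cons] at hg
    cases hC with
    | cons _ c' l' hc' hC' => exact ih hg.2 _ hC'

lemma exhaust (l : List (M e)) (hg : Gd α l) : ∀ Q, (∃ m l', l = m :: l' ∧ ∀ d, H.nf m d ≠ 0 → d ∉ Q) ∨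
    H.Crit Q l ∨ (∃ τ w, H.Pair Q l τ w) ∨ ∃ σ w, H.Pair Q σ l w := by
  induction l with
  | nil => intro Q; exact Or.inr (Or.inl (Crit.nil Q))
  | cons m l ih =>
    intro Q
    rw [gd_cons] at hg
    by_cases hQ : ∀ d, H.nf m d ≠ 0 → d ∉ Q
    · exact Or.inl ⟨m, l, rfl, hQ⟩
    right
    by_cases hlet : ∃ c, m = α c
    · obtain ⟨c, rfl⟩ := hlet
      have hc : c ∈ Q := by
        by_contra hc
        apply hQ
        intro d hd
        rw [H.nf_gen] at hd
        have : c = d := by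
          by_contra hne
          exact hd (by simp [hne])
        rwa [← this]
      rcases ih hg.2 (H.next Q c) with ⟨m', l', rfl, h1⟩ | h1 | ⟨τ, w, h1⟩ | ⟨σ, w, h1⟩
      · rw [gd_cons] at hg
        exact Or.inr (Or.inl ⟨_, _, Pair.here Q c m' l' hc hg.2.1.1 hg.2.1.2 h1⟩)
      · exact Or.inl (Crit.cons Q c l hc h1)
      · exact Or.inr (Or.inl ⟨_, _, Pair.there Q c _ _ _ hc h1⟩)
      · exact Or.inr (Or.inr ⟨_, _, Pair.there Q c _ _ _ hc h1⟩)
    · push Not at hQ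
      obtain ⟨d0, hd0, hd0Q⟩ := hQ
      obtain ⟨c, hc, hmax⟩ := Finset.exists_max_image (Q.filter fun d => H.nf m d ≠ 0) id
        ⟨d0, by simp [hd0, hd0Q]⟩
      obtain ⟨hcQ, hcm⟩ := Finset.mem_filter.1 hc
      obtain ⟨ν, hν, hmν, hnf, hcmν⟩ := H.nf_split m hg.1.1 c hcm
      have hν0 : ν ≠ 0 := by
        rintro rfl
        exact hlet ⟨c, by simpa using hmν⟩
      right; right
      refine ⟨α c :: ν :: l, [c], ?_⟩
      rw [hmν]
      refine Pair.here Q c ν l hcQ hν hν0 ?_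
      intro d hd hdn
      rcases H.mem_next.1 hdn with h1 | ⟨h1, h2⟩
      · exact h1 (hcmν d hd)
      · have := hmax d (Finset.mem_filter.2 ⟨h1, by rw [hnf, Finsupp.add_apply]; omega⟩)
        exact absurd h2 (not_lt.2 this)

lemma exhaust_univ (l : List (M e)) (hg : Gd α l) :
    H.Crit Finset.univ l ∨ (∃ τ w, H.Pair Finset.univ l τ w) ∨ ∃ σ w, H.Pair Finset.univ σ l w := by
  rcases H.exhaust l hg Finset.univ with ⟨m, l', rfl, h⟩ | h
  · rw [gd_cons] at hg
    obtain ⟨c, hc⟩ := H.nf_ne m hg.1.1 hg.1.2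
    exact absurd (Finset.mem_univ c) (h c hc)
  · exact h

lemma triang {Q σ τ w} (h : H.Pair Q σ τ w) : ∀ {σ' τ' w'}, Gd α σ → Face σ τ' → H.Pair Q σ' τ' w' →
    τ' = τ ∨ H.lt (H.tot σ') (H.tot σ) ∨ (H.tot σ' = H.tot σ ∧ w < w') := by
  induction h with
  | here Q c m l hc hm h0 hd =>
    intro σ' τ' w' hg hf hp
    have htot := H.face_tot hf hg
    rw [H.pair_tot hp] at htot
    cases hf with
    | merge => exact Or.inl rfl
    | cons _ _ t hf' =>
      right
      rcases htot with htot | htot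
      · right
        refine ⟨htot, ?_⟩
        generalize hτ : α c :: t = τ0 at hp
        cases hp with
        | here _ c' m' l' hc' hm' h0' hd' => exact absurd (List.cons.inj hτ).1.symm (H.irr hm' h0')
        | there _ c' σ1 τ1 w1 hc' hp' =>
          rw [H.a_inj (List.cons.inj hτ).1]
          obtain ⟨x, xs, rfl⟩ := List.exists_cons_of_ne_nil (H.pair_word hp')
          exact List.cons_lt_cons_self.2 (List.nil_lt_cons _ _)
      · exact Or.inl htot
  | there Q c σ τ w hc hp0 ih =>
    intro σ' τ' w' hg hf hp
    have htot := H.face_tot hf hg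
    rw [H.pair_tot hp] at htot
    rcases htot with htot | htot
    swap
    · exact Or.inr (Or.inl htot)
    generalize hσ : α c :: σ = σ0 at hf
    cases hf with
    | merge a b l =>
      obtain ⟨rfl, rfl⟩ := List.cons.inj hσ
      obtain ⟨c2, l2, hx, hc2⟩ := H.pair_head_σ hp0
      obtain ⟨rfl, rfl⟩ := List.cons.inj hx
      right; right
      refine ⟨htot, ?_⟩
      have hadd : H.nf (α c + α c2) = H.nf (α c) + H.nf (α c2) := by
        rw [← H.pair_tot hp] at htot
        simp only [tot_cons, ← add_assoc] at htot
        exact add_right_cancel htot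
      have hcm := H.nf_cm _ _ hadd
      rcases H.mem_next.1 hc2 with h | ⟨h, hlt⟩
      · exact absurd hcm h
      generalize hτ : (α c + α c2) :: l = τ0 at hp
      cases hp with
      | here _ c' m' l' hc' hm' h0' hd' =>
        have h1 := (List.cons.inj hτ).1
        have : c2 ≤ c' := by
          refine H.here_max hm' hd' c2 ?_ h
          rw [← h1, hadd, H.nf_gen, H.nf_gen]; simp
        exact List.cons_lt_cons_iff.2 (Or.inl (lt_of_lt_of_le hlt this))
      | there _ c' σ1 τ1 w1 hc' hp' =>
        exact absurd (List.cons.inj hτ).1 (H.irr (gen_mem α c2) (H.a_ne c2))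
    | cons a l t hf' =>
      obtain ⟨rfl, rfl⟩ := List.cons.inj hσ
      generalize hτ : α c :: t = τ0 at hp
      cases hp with
      | here _ c' m' l' hc' hm' h0' hd' => exact absurd (List.cons.inj hτ).1.symm (H.irr hm' h0')
      | there _ c' σ1 τ1 w1 hc' hp' =>
        obtain ⟨h1, rfl⟩ := List.cons.inj hτ
        have := H.a_inj h1
        subst this
        rw [gd_cons] at hg
        rcases ih hg.2 hf' hp' with h | h | ⟨h, h'⟩
        · left; rw [h]
        · right; left
          simp only [tot_cons]
          rw [add_comm, add_comm (H.nf _)]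
          exact H.lt_add _ _ _ h
        · right; right
          exact ⟨htot, List.cons_lt_cons_self.2 h'⟩

end NF
end ASGP
namespace ASGP
open ASG

section order
variable {e n : ℕ} {α : Fin n → M e}

lemma sgLE_refl (a : M e) : sgLE α a a := ⟨0, zero_mem _, add_zero a⟩

lemma sgLE_trans {a b c : M e} (h : sgLE α a b) (h' : sgLE α b c) : sgLE α a c := by
  obtain ⟨x, hx, rfl⟩ := h
  obtain ⟨y, hy, rfl⟩ := h'
  exact ⟨x + y, add_mem hx hy, by rw [add_assoc]⟩

lemma sgLE_le {a b : M e} (h : sgLE α a b) : a ≤ b := by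
  obtain ⟨x, hx, rfl⟩ := h
  exact le_self_add

lemma sgLE_antisymm {a b : M e} (h : sgLE α a b) (h' : sgLE α b a) : a = b :=
  le_antisymm (sgLE_le h) (sgLE_le h')

lemma sgLT_trans {a b c : M e} (h : sgLT α a b) (h' : sgLT α b c) : sgLT α a c := by
  refine ⟨sgLE_trans h.1 h'.1, ?_⟩
  rintro rfl
  exact h.2 (sgLE_antisymm h.1 h'.1)

lemma sgLT_asymm {a b : M e} (h : sgLT α a b) : ¬ sgLT α b a :=
  fun h' => h.2 (sgLE_antisymm h.1 h'.1)

end order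

section bd
variable {e n : ℕ} (α : Fin n → M e) (k : Type) [Field k]

def Int0 (S : Finset (M e)) (v : M e) : Prop := v ≠ 0 ∧ ∃ w ∈ S, sgLT α v w

def sgn (S : Finset (M e)) (v : M e) : k := (-1 : k) ^ (S.filter fun w => sgLT α w v).card

def bd (S : Finset (M e)) : Finset (M e) →₀ k :=
  ∑ v ∈ S.filter (Int0 α S), sgn α k S v • Finsupp.single (S.erase v) 1

variable {α k}

lemma sgn_ne (S : Finset (M e)) (v : M e) : sgn α k S v ≠ 0 := by
  unfold sgn; exact pow_ne_zero _ (by simp)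

lemma erase_inj' {S : Finset (M e)} {v w : M e} (hv : v ∈ S) (h : S.erase v = S.erase w) :
    v = w := by
  by_contra hne
  have : v ∈ S.erase w := Finset.mem_erase.2 ⟨hne, hv⟩
  rw [← h] at this
  simp at this

lemma bd_ne {S T : Finset (M e)} : bd α k S T ≠ 0 ↔ ∃ v ∈ S, Int0 α S v ∧ T = S.erase v := by
  constructor
  · intro h
    rw [bd, Finsupp.finsetSum_apply] at h
    obtain ⟨v, hv, hne⟩ := Finset.exists_ne_zero_of_sum_ne_zero h
    obtain ⟨h1, h2⟩ := Finset.mem_filter.1 hv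
    refine ⟨v, h1, h2, ?_⟩
    by_contra hT
    apply hne
    simp [Ne.symm hT]
  · rintro ⟨v, hv, hi, rfl⟩
    rw [bd, Finsupp.finsetSum_apply, Finset.sum_eq_single v]
    · simpa using sgn_ne S v
    · intro w hw hne
      have : S.erase w ≠ S.erase v := fun h => hne (erase_inj' (Finset.mem_filter.1 hw).1 h)
      simp [this]
    · intro h
      exact absurd (Finset.mem_filter.2 ⟨hv, hi⟩) h

lemma int_erase {S : Finset (M e)} {v w : M e} (hv : Int0 α S v) :
    Int0 α (S.erase v) w ↔ Int0 α S w := by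
  constructor
  · rintro ⟨h0, x, hx, hlt⟩
    exact ⟨h0, x, Finset.mem_of_mem_erase hx, hlt⟩
  · rintro ⟨h0, x, hx, hlt⟩
    refine ⟨h0, ?_⟩
    by_cases hxv : x = v
    · subst hxv
      obtain ⟨-, y, hy, hxy⟩ := hv
      exact ⟨y, Finset.mem_erase.2 ⟨hxy.2.symm, hy⟩, sgLT_trans hlt hxy⟩
    · exact ⟨x, Finset.mem_erase.2 ⟨hxv, hx⟩, hlt⟩

lemma sgn_erase {S : Finset (M e)} {v w : M e} (hv : v ∈ S) :
    sgn α k (S.erase v) w = if sgLT α v w then - sgn α k S w else sgn α k S w := by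
  unfold sgn
  rw [Finset.filter_erase]
  split_ifs with h
  · have hm : v ∈ S.filter (fun x => sgLT α x w) := Finset.mem_filter.2 ⟨hv, h⟩
    rw [← Finset.card_erase_add_one hm, pow_succ]
    ring
  · rw [Finset.erase_eq_of_notMem]
    simp [h]

lemma bd_bd {S : Finset (M e)} (hS : (S : Set (M e)).Pairwise (cmp2 α)) :
    Finsupp.linearCombination k (bd α k) (bd α k S) = 0 := by
  have h1 : Finsupp.linearCombination k (bd α k) (bd α k S) =
      ∑ p ∈ (S.filter (Int0 α S)).sigma (fun v => (S.erase v).filter (Int0 α (S.erase v))),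
        (sgn α k S p.1 * sgn α k (S.erase p.1) p.2) •
          Finsupp.single ((S.erase p.1).erase p.2) (1 : k) := by
    rw [Finset.sum_sigma]
    conv_lhs => rw [bd]
    simp only [map_sum, map_smul, Finsupp.linearCombination_single, one_smul]
    refine Finset.sum_congr rfl fun v _ => ?_
    rw [bd, Finset.smul_sum]
    refine Finset.sum_congr rfl fun w _ => ?_
    rw [smul_smul]
  rw [h1]
  have key : ∀ p : (Σ _ : M e, M e), p ∈ (S.filter (Int0 α S)).sigma
      (fun v => (S.erase v).filter (Int0 α (S.erase v))) ↔
      (p.1 ∈ S ∧ Int0 α S p.1) ∧ (p.2 ∈ S ∧ Int0 α S p.2) ∧ p.2 ≠ p.1 := by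
    intro p
    simp only [Finset.mem_sigma, Finset.mem_filter, Finset.mem_erase]
    constructor
    · rintro ⟨⟨a, b⟩, ⟨c, d⟩, f⟩
      exact ⟨⟨a, b⟩, ⟨d, (int_erase b).1 f⟩, c⟩
    · rintro ⟨⟨a, b⟩, ⟨d, f⟩, c⟩
      exact ⟨⟨a, b⟩, ⟨c, d⟩, (int_erase b).2 f⟩
  refine Finset.sum_involution (fun p _ => ⟨p.2, p.1⟩) ?_ ?_ ?_ ?_
  · intro p hp
    obtain ⟨⟨a, b⟩, ⟨c, d⟩, f⟩ := (key p).1 hp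
    rw [Finset.erase_right_comm (a := p.2), ← add_smul]
    have : sgn α k S p.1 * sgn α k (S.erase p.1) p.2 + sgn α k S p.2 * sgn α k (S.erase p.2) p.1 = 0 := by
      rw [sgn_erase a, sgn_erase c]
      rcases hS a c f.symm with h | h
      · have h' : sgLT α p.1 p.2 := ⟨h, f.symm⟩
        rw [if_pos h', if_neg (sgLT_asymm h')]
        ring
      · have h' : sgLT α p.2 p.1 := ⟨h, f⟩
        rw [if_pos h', if_neg (sgLT_asymm h')]
        ring
    rw [this, zero_smul]
  · intro p hp _ heq
    obtain ⟨_, _, f⟩ := (key p).1 hp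
    exact f (congrArg Sigma.fst heq)
  · intro p hp
    obtain ⟨a, b, f⟩ := (key p).1 hp
    exact (key _).2 ⟨b, a, f.symm⟩
  · intro p hp
    rfl

end bd

namespace NF
variable {e n : ℕ} {α : Fin n → M e}

/-- partial sums -/
def ps : M e → List (M e) → Finset (M e)
  | s, [] => {s}
  | s, m :: l => insert s (ps (s + m) l)

lemma self_mem (s : M e) (l : List (M e)) : s ∈ ps s l := by
  cases l <;> simp [ps]

lemma top_mem (s : M e) (l : List (M e)) : s + l.sum ∈ ps s l := by
  induction l generalizing s with
  | nil => simp [ps]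
  | cons m l ih =>
    simp only [ps, List.sum_cons, Finset.mem_insert]
    right; rw [← add_assoc]; exact ih _

lemma ps_ge {s : M e} {l : List (M e)} (hg : Gd α l) {μ : M e} (h : μ ∈ ps s l) : sgLE α s μ := by
  induction l generalizing s with
  | nil => simp only [ps, Finset.mem_singleton] at h; rw [h]; exact sgLE_refl _
  | cons m l ih =>
    rw [gd_cons] at hg
    simp only [ps, Finset.mem_insert] at h
    rcases h with rfl | h
    · exact sgLE_refl _
    · exact sgLE_trans ⟨m, hg.1.1, rfl⟩ (ih hg.2 h)

lemma ps_le {s : M e} {l : List (M e)} (hg : Gd α l) {μ : M e} (h : μ ∈ ps s l) :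
    sgLE α μ (s + l.sum) := by
  induction l generalizing s with
  | nil => simp only [ps, Finset.mem_singleton] at h; rw [h]; simpa using sgLE_refl _
  | cons m l ih =>
    rw [gd_cons] at hg
    have := top_mem (s + m) l
    rw [add_assoc] at this
    simp only [ps, Finset.mem_insert] at h
    rcases h with rfl | h
    · exact sgLE_trans ⟨m, hg.1.1, rfl⟩ (ps_ge hg.2 this)
    · have := ih hg.2 h
      rwa [add_assoc] at this

lemma not_mem {s m : M e} {l : List (M e)} (hg : Gd α (m :: l)) : s ∉ ps (s + m) l := by
  intro h
  rw [gd_cons] at hg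
  have h1 := sgLE_antisymm (ps_ge hg.2 h) ⟨m, hg.1.1, rfl⟩
  exact hg.1.2 (by simpa using h1)

lemma ps_card {s : M e} {l : List (M e)} (hg : Gd α l) : (ps s l).card = l.length + 1 := by
  induction l generalizing s with
  | nil => simp [ps]
  | cons m l ih =>
    rw [ps, Finset.card_insert_of_notMem (not_mem hg), ih (gd_cons.1 hg).2]; rfl

lemma ps_chain {s : M e} {l : List (M e)} (hg : Gd α l) :
    (ps s l : Set (M e)).Pairwise (cmp2 α) := by
  induction l generalizing s with
  | nil => simp [ps]
  | cons m l ih =>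
    have hg0 := hg
    rw [gd_cons] at hg
    intro a ha b hb hab
    have ha' : a = s ∨ a ∈ ps (s + m) l := by simpa [ps] using ha
    have hb' : b = s ∨ b ∈ ps (s + m) l := by simpa [ps] using hb
    rcases ha' with rfl | ha'
    · exact Or.inl (ps_ge hg0 hb)
    · rcases hb' with rfl | hb'
      · exact Or.inr (ps_ge hg0 ha)
      · exact ih hg.2 ha' hb' hab

lemma ps_inj {s : M e} {l l' : List (M e)} (hg : Gd α l) (hg' : Gd α l')
    (h : ps s l = ps s l') : l = l' := by
  induction l generalizing s l' with
  | nil =>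
    have h1 := ps_card (s := s) hg
    rw [h, ps_card hg'] at h1
    simp at h1
    exact h1.symm
  | cons m l ih =>
    cases l' with
    | nil =>
      have h1 := ps_card (s := s) hg
      rw [h, ps_card hg'] at h1
      simp at h1
    | cons m' l' =>
      have h2 : ps (s + m) l = ps (s + m') l' := by
        have := congrArg (fun S => S.erase s) h
        simp only [ps] at this
        rwa [Finset.erase_insert (not_mem hg), Finset.erase_insert (not_mem hg')] at this
      have h3 : s + m = s + m' := by
        apply sgLE_antisymm (α := α)
        · exact ps_ge (gd_cons.1 hg).2 (by rw [h2]; exact self_mem _ _)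
        · exact ps_ge (gd_cons.1 hg').2 (by rw [← h2]; exact self_mem _ _)
      rw [h3] at h2
      rw [add_left_cancel h3, ih (gd_cons.1 hg).2 (gd_cons.1 hg').2 h2]

lemma add_ne {a b : M e} (h : a ≠ 0) : a + b ≠ 0 := by
  intro h0
  apply h
  have : a ≤ 0 := by rw [← h0]; exact le_self_add
  exact le_antisymm this (zero_le)

lemma face_gd {σ τ : List (M e)} (h : Face σ τ) (hg : Gd α σ) : Gd α τ := by
  induction h with
  | merge a b l =>
    rw [gd_cons, gd_cons] at hg
    rw [gd_cons]
    exact ⟨⟨add_mem hg.1.1 hg.2.1.1, add_ne hg.1.2⟩, hg.2.2⟩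
  | cons a l l' hf ih =>
    rw [gd_cons] at hg ⊢
    exact ⟨hg.1, ih hg.2⟩

lemma sum_ne {m : M e} {l : List (M e)} (hg : Gd α (m :: l)) (s : M e) :
    s ≠ s + (m :: l).sum := by
  intro h
  rw [gd_cons] at hg
  have : (m :: l).sum = 0 := by simpa using h
  rw [List.sum_cons] at this
  exact add_ne hg.1.2 this

lemma ps_face {s : M e} {l l' : List (M e)} (hf : Face l l') (hg : Gd α l) :
    ∃ v ∈ ps s l, v ≠ s ∧ v ≠ s + l.sum ∧ ps s l' = (ps s l).erase v := by
  induction hf generalizing s with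
  | merge a b l =>
    have hg' := (gd_cons.1 hg).2
    refine ⟨s + a, ?_, ?_, ?_, ?_⟩
    · simp [ps]
    · have := (gd_cons.1 hg).1.2
      simpa using this
    · have := sum_ne hg' (s + a)
      rw [List.sum_cons, ← add_assoc]; exact this
    · simp only [ps]
      have hne : s ≠ s + a := by simpa using (gd_cons.1 hg).1.2
      rw [Finset.erase_insert_of_ne hne, Finset.erase_insert (not_mem hg'), add_assoc]
  | cons a l l' hf ih =>
    obtain ⟨v, hv, h1, h2, h3⟩ := ih (s := s + a) (gd_cons.1 hg).2
    have hvs : v ≠ s := by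
      rintro rfl; exact not_mem hg hv
    refine ⟨v, ?_, hvs, ?_, ?_⟩
    · simp [ps, hv]
    · rw [List.sum_cons, ← add_assoc]; exact h2
    · simp only [ps]
      rw [h3, Finset.erase_insert_of_ne hvs.symm]

lemma face_of_erase {s v : M e} {l : List (M e)} (hg : Gd α l) (hv : v ∈ ps s l) (hs : v ≠ s)
    (ht : v ≠ s + l.sum) : ∃ l', Face l l' ∧ (ps s l).erase v = ps s l' := by
  induction l generalizing s with
  | nil => simp [ps, hs] at hv
  | cons a l ih =>
    have hva : v ∈ ps (s + a) l := by
      simpa [ps, hs] using hv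
    by_cases h : v = s + a
    · cases l with
      | nil => exact absurd (by simpa using h) ht
      | cons b l =>
        refine ⟨(a + b) :: l, Face.merge _ _ _, ?_⟩
        subst h
        simp only [ps]
        rw [Finset.erase_insert_of_ne hs.symm, Finset.erase_insert (not_mem (gd_cons.1 hg).2),
          add_assoc]
    · obtain ⟨l', h1, h2⟩ := ih (gd_cons.1 hg).2 hva h (by
        rw [List.sum_cons, ← add_assoc] at ht; exact ht)
      refine ⟨a :: l', Face.cons _ _ _ h1, ?_⟩
      simp only [ps]
      rw [Finset.erase_insert_of_ne hs.symm, h2]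

lemma exists_ps : ∀ (N : ℕ) (s : M e) (S : Finset (M e)), S.card = N + 1 → s ∈ S →
    (∀ μ ∈ S, sgLE α s μ) → (S : Set (M e)).Pairwise (cmp2 α) → ∃ l, Gd α l ∧ S = ps s l := by
  intro N
  induction N with
  | zero =>
    intro s S hc hs _ _
    obtain ⟨a, rfl⟩ := Finset.card_eq_one.1 hc
    have : s = a := by simpa using hs
    subst this
    exact ⟨[], by simp [Gd], rfl⟩
  | succ N ih =>
    intro s S hc hs hle hch
    have hc' : (S.erase s).card = N + 1 := by rw [Finset.card_erase_of_mem hs, hc]; rfl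
    have hne : (S.erase s).Nonempty := by
      rw [← Finset.card_pos, hc']; omega
    obtain ⟨t, ht, hmin⟩ := Finset.exists_min_image (S.erase s) (fun x => Finsupp.degree x) hne
    have hch' : ((S.erase s : Finset (M e)) : Set (M e)).Pairwise (cmp2 α) :=
      hch.mono (Finset.coe_subset.2 (Finset.erase_subset _ _))
    obtain ⟨l, hl, hl2⟩ := ih t (S.erase s) hc' ht (by
      intro μ hμ
      by_cases hμt : t = μ
      · rw [hμt]; exact sgLE_refl _
      rcases hch' ht hμ hμt with h | h
      · exact h
      · obtain ⟨δ, hδ, rfl⟩ := h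
        have := hmin _ hμ
        simp only [map_add] at this
        have h0 : Finsupp.degree δ = 0 := by omega
        rw [Finsupp.degree_eq_zero_iff] at h0
        exact absurd (by simp [h0]) hμt) hch'
    obtain ⟨htne, htS⟩ := Finset.mem_erase.1 ht
    obtain ⟨δ, hδ, rfl⟩ := hle t htS
    refine ⟨δ :: l, gd_cons.2 ⟨⟨hδ, ?_⟩, hl⟩, ?_⟩
    · rintro rfl; simp at htne
    · rw [ps, ← hl2, Finset.insert_erase hs]

lemma face_iff {S : Finset (M e)} {i : ℕ} :
    (IsBTFace α S ∧ S.card = i + 1) ↔ ∃ l, Gd α l ∧ l.length = i ∧ S = ps 0 l := by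
  constructor
  · rintro ⟨⟨h1, h2, h3⟩, h4⟩
    obtain ⟨l, hl, rfl⟩ := exists_ps i 0 S h4 h2 (fun μ hμ => ⟨μ, h1 μ hμ, zero_add μ⟩) h3
    refine ⟨l, hl, ?_, rfl⟩
    rw [ps_card hl] at h4
    omega
  · rintro ⟨l, hl, rfl, rfl⟩
    refine ⟨⟨fun μ hμ => ?_, self_mem _ _, ps_chain hl⟩, ps_card hl⟩
    obtain ⟨δ, hδ, h⟩ := ps_ge hl hμ
    rw [zero_add] at h
    rwa [← h]

lemma int_ps {l : List (M e)} (hg : Gd α l) {v : M e} (hv : v ∈ ps 0 l) :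
    Int0 α (ps 0 l) v ↔ v ≠ 0 ∧ v ≠ 0 + l.sum := by
  constructor
  · rintro ⟨h0, w, hw, hlt⟩
    refine ⟨h0, ?_⟩
    rintro rfl
    exact hlt.2 (sgLE_antisymm hlt.1 (ps_le hg hw))
  · rintro ⟨h0, h1⟩
    exact ⟨h0, _, top_mem 0 l, ps_le hg hv, h1⟩

lemma bd_ps {k : Type} [Field k] {l : List (M e)} (hg : Gd α l) {T : Finset (M e)} :
    bd α k (ps 0 l) T ≠ 0 ↔ ∃ l', Face l l' ∧ T = ps 0 l' := by
  rw [bd_ne]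
  constructor
  · rintro ⟨v, hv, hi, rfl⟩
    rw [int_ps hg hv] at hi
    obtain ⟨l', h1, h2⟩ := face_of_erase hg hv hi.1 hi.2
    exact ⟨l', h1, h2⟩
  · rintro ⟨l', hf, rfl⟩
    obtain ⟨v, hv, h1, h2, h3⟩ := ps_face (s := 0) hf hg
    exact ⟨v, hv, (int_ps hg hv).2 ⟨h1, h2⟩, h3⟩

lemma face_length {l l' : List (M e)} (h : Face l l') : l.length = l'.length + 1 := by
  induction h with
  | merge => simp
  | cons a l l' hf ih => simp [ih]

variable (H : NF α)

def wd (l : List (M e)) : List (Fin n) :=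
  if h : ∃ w τ, H.Pair Finset.univ l τ w then h.choose else []

lemma wd_eq {l τ w} (h : H.Pair Finset.univ l τ w) : H.wd l = w := by
  have hh : ∃ w τ, H.Pair Finset.univ l τ w := ⟨w, τ, h⟩
  rw [wd, dif_pos hh]
  obtain ⟨τ', h'⟩ := hh.choose_spec
  exact H.word_unique h' h

def Rl (l' l : List (M e)) : Prop :=
  l'.sum = l.sum ∧ (H.lt (H.tot l') (H.tot l) ∨ (H.tot l' = H.tot l ∧ H.wd l < H.wd l'))

lemma Rl_irrefl (l : List (M e)) : ¬ H.Rl l l := by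
  rintro ⟨-, h | h⟩
  · exact H.lt_irrefl _ h
  · exact _root_.lt_irrefl _ h.2

lemma Rl_trans {a b c : List (M e)} (h : H.Rl a b) (h' : H.Rl b c) : H.Rl a c := by
  refine ⟨h.1.trans h'.1, ?_⟩
  rcases h.2 with h1 | ⟨h1, h2⟩ <;> rcases h'.2 with h3 | ⟨h3, h4⟩
  · exact Or.inl (H.lt_trans _ _ _ h1 h3)
  · rw [h3] at h1; exact Or.inl h1
  · rw [← h1] at h3; exact Or.inl h3
  · exact Or.inr ⟨h1.trans h3, _root_.lt_trans h4 h2⟩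

lemma finite_sum (x : M e) : {l : List (M e) | Gd α l ∧ l.sum = x}.Finite := by
  refine Set.Finite.of_finite_image (f := ps 0) ?_ ?_
  · refine Set.Finite.subset (Finset.finite_toSet (Finset.Iic x).powerset) ?_
    rintro _ ⟨l, ⟨hl, rfl⟩, rfl⟩
    simp only [Finset.coe_powerset, Set.mem_preimage, Set.mem_powerset_iff]
    intro μ hμ
    have := sgLE_le (ps_le hl hμ)
    rw [zero_add] at this
    simpa using this
  · rintro l ⟨hl, -⟩ l' ⟨hl', -⟩ h
    exact ps_inj hl hl' h

def rkl (l : List (M e)) : ℕ := {l' : List (M e) | Gd α l' ∧ H.Rl l' l}.ncard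

lemma rkl_lt {l' l : List (M e)} (hg : Gd α l') (h : H.Rl l' l) : H.rkl l' < H.rkl l := by
  refine Set.ncard_lt_ncard ?_ ?_
  · rw [Set.ssubset_iff_of_subset]
    · exact ⟨l', ⟨hg, h⟩, fun hh => H.Rl_irrefl _ hh.2⟩
    · rintro x ⟨hx, hx2⟩
      exact ⟨hx, H.Rl_trans hx2 h⟩
  · exact (finite_sum (α := α) l.sum).subset fun x hx => ⟨hx.1, hx.2.1⟩

def toL (α : Fin n → M e) (S : Finset (M e)) : List (M e) :=
  if h : ∃ l, Gd α l ∧ S = ps 0 l then h.choose else []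

lemma toL_ps {l : List (M e)} (hg : Gd α l) : toL α (ps 0 l) = l := by
  have hh : ∃ l', Gd α l' ∧ ps 0 l = ps 0 l' := ⟨l, hg, rfl⟩
  rw [toL, dif_pos hh]
  exact (ps_inj hg hh.choose_spec.1 hh.choose_spec.2).symm

def FF (α : Fin n → M e) (i : ℕ) : Set (Finset (M e)) := {S | IsBTFace α S ∧ S.card = i + 1}

def KK : Set (Finset (M e)) := {S | ∃ l, Gd α l ∧ H.Crit Finset.univ l ∧ S = ps 0 l}

def PP (S T : Finset (M e)) : Prop :=
  ∃ l l' w, Gd α l ∧ H.Pair Finset.univ l l' w ∧ S = ps 0 l ∧ T = ps 0 l'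

theorem morse (k : Type) [Field k] :
    MorseData (bd α k) (FF α) H.KK H.PP (fun S => H.rkl (toL α S)) where
  hF0 := by
    intro b hb
    obtain ⟨l, hl, h0, rfl⟩ := face_iff.1 hb
    ext T
    by_contra hne
    obtain ⟨l', hf, -⟩ := (bd_ps hl).1 hne
    have := face_length hf
    omega
  hF := by
    intro i b hb c hc
    obtain ⟨l, hl, h0, rfl⟩ := face_iff.1 hb
    obtain ⟨l', hf, rfl⟩ := (bd_ps hl).1 hc
    have := face_length hf
    exact face_iff.2 ⟨l', face_gd hf hl, by omega, rfl⟩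
  hdd := fun i b hb => bd_bd hb.1.2.2
  ex := by
    intro i b hb
    obtain ⟨l, hl, h0, rfl⟩ := face_iff.1 hb
    rcases H.exhaust_univ l hl with h | ⟨τ, w, h⟩ | ⟨σ, w, h⟩
    · exact Or.inl ⟨l, hl, h, rfl⟩
    · exact Or.inr (Or.inl ⟨_, l, τ, w, hl, h, rfl, rfl⟩)
    · exact Or.inr (Or.inr ⟨_, σ, l, w, H.pair_gd h hl, h, rfl, rfl⟩)
  KD := by
    rintro b ⟨l, hl, hC, rfl⟩ τ ⟨l1, l', w, hl1, hp, h1, rfl⟩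
    have := ps_inj hl hl1 h1
    subst this
    exact H.crit_not_pair hp hC
  hK := by
    rintro i b hb c ⟨l', hl', hC, rfl⟩
    by_contra hne
    obtain ⟨l, hl, h0, rfl⟩ := face_iff.1 hb
    obtain ⟨l1, hf, h1⟩ := (bd_ps hl).1 hne
    have := ps_inj hl' (face_gd hf hl) h1
    subst this
    exact H.face_not_crit hf hl _ hC
  Pinj := by
    rintro σ σ' τ ⟨l, l', w, hl, hp, rfl, rfl⟩ ⟨l1, l1', w1, hl1, hp1, rfl, h⟩
    have := ps_inj (face_gd (H.pair_face hp) hl) (face_gd (H.pair_face hp1) hl1) h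
    subst this
    rw [H.pair_inj hp hp1]
  PF := by
    rintro i σ τ ⟨l, l', w, hl, hp, rfl, rfl⟩ hτ
    have hg' := face_gd (H.pair_face hp) hl
    obtain ⟨l1, hl1, h0, h1⟩ := face_iff.1 hτ
    have := ps_inj hg' hl1 h1
    subst this
    exact face_iff.2 ⟨l, hl, by rw [face_length (H.pair_face hp), h0], rfl⟩
  Pne := by
    rintro σ τ ⟨l, l', w, hl, hp, rfl, rfl⟩
    exact (bd_ps hl).2 ⟨l', H.pair_face hp, rfl⟩
  tri := by
    rintro σ τ σ' τ' ⟨l, l', w, hl, hp, rfl, rfl⟩ hd ⟨l1, l1', w1, hl1, hp1, rfl, rfl⟩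
    obtain ⟨l2, hf, h2⟩ := (bd_ps hl).1 hd
    have := ps_inj (face_gd (H.pair_face hp1) hl1) (face_gd hf hl) h2
    subst this
    rcases H.triang hp hl hf hp1 with h | h
    · left; rw [h]
    · right
      simp only [toL_ps hl, toL_ps hl1]
      refine H.rkl_lt hl1 ⟨?_, ?_⟩
      · rw [← face_sum (H.pair_face hp1), face_sum hf]
      · rw [H.wd_eq hp, H.wd_eq hp1]; exact h

end NF
end ASGP
namespace ASGP
open ASG

section gb
variable {e n : ℕ} (α : Fin n → M e)

def ph : (Fin n →₀ ℕ) →ₗ[ℕ] M e := Finsupp.linearCombination ℕ α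

def Std (ord : LinearOrder (Fin n →₀ ℕ)) (a : Fin n →₀ ℕ) : Prop :=
  ∀ b, ph α b = ph α a → ord.le a b

variable {α}

lemma ph_single (c : Fin n) : ph α (Finsupp.single c 1) = α c := by
  simp [ph]

lemma ph_mem (a : Fin n →₀ ℕ) : ph α a ∈ sg α := by
  rw [ph, Finsupp.linearCombination_apply, Finsupp.sum]
  exact sum_mem fun i _ => nsmul_mem (NF.gen_mem α i) _

lemma exists_ph {μ : M e} (h : μ ∈ sg α) : ∃ a, ph α a = μ := by
  induction h using AddSubmonoid.closure_induction with
  | mem x hx => obtain ⟨c, rfl⟩ := hx; exact ⟨_, ph_single c⟩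
  | zero => exact ⟨0, map_zero _⟩
  | add x y _ _ hx hy =>
    obtain ⟨a, rfl⟩ := hx
    obtain ⟨b, rfl⟩ := hy
    exact ⟨a + b, map_add _ _ _⟩

lemma le_degree_ph (hα : ∀ i, α i ≠ 0) (a : Fin n →₀ ℕ) (i : Fin n) :
    a i ≤ Finsupp.degree (ph α a) := by
  rw [ph, Finsupp.linearCombination_apply, Finsupp.sum_fintype _ _ (by simp), map_sum]
  have h1 : a i ≤ Finsupp.degree (a i • α i) := by
    rw [map_nsmul, smul_eq_mul]
    have : Finsupp.degree (α i) ≠ 0 := by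
      rw [Ne, Finsupp.degree_eq_zero_iff]; exact hα i
    exact Nat.le_mul_of_pos_right _ (by omega)
  exact h1.trans (Finset.single_le_sum (f := fun j => Finsupp.degree (a j • α j))
    (fun _ _ => Nat.zero_le _) (Finset.mem_univ i))

lemma fiber_finite (hα : ∀ i, α i ≠ 0) (μ : M e) : {a | ph α a = μ}.Finite := by
  refine (Set.finite_Iic (Finsupp.equivFunOnFinite.symm
    (fun _ : Fin n => Finsupp.degree μ))).subset ?_
  rintro a rfl
  intro i
  simpa using le_degree_ph hα a i

lemma ph_eq_zero (hα : ∀ i, α i ≠ 0) {a : Fin n →₀ ℕ} (h : ph α a = 0) : a = 0 := by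
  ext i
  have := le_degree_ph hα a i
  rw [h, map_zero] at this
  simpa using this

lemma exists_split {a : Fin n →₀ ℕ} {c : Fin n} (h : a c ≠ 0) : ∃ b, a = Finsupp.single c 1 + b := by
  refine ⟨a - Finsupp.single c 1, ?_⟩
  rw [add_tsub_cancel_of_le]
  rw [Finsupp.single_le_iff]; omega

lemma exists_ne {a : Fin n →₀ ℕ} (h : a ≠ 0) : ∃ c, a c ≠ 0 := by
  by_contra! hc
  exact h (Finsupp.ext hc)

lemma ph_gen (hα : ∀ i, α i ≠ 0) (hinj : Function.Injective α)
    (hirr : ∀ i, ¬ ∃ a ∈ sg α, ∃ b ∈ sg α, a ≠ 0 ∧ b ≠ 0 ∧ a + b = α i)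
    {a : Fin n →₀ ℕ} {c : Fin n} (h : ph α a = α c) : a = Finsupp.single c 1 := by
  have ha : a ≠ 0 := by
    rintro rfl
    rw [map_zero] at h
    exact hα c h.symm
  obtain ⟨i, hi⟩ := exists_ne ha
  obtain ⟨b, rfl⟩ := exists_split hi
  rw [map_add, ph_single] at h
  have hb : ph α b = 0 := by
    by_contra hb
    exact hirr c ⟨α i, AddSubmonoid.subset_closure ⟨i, rfl⟩, _, ph_mem b, hα i, hb, h⟩
  rw [hb, add_zero] at h
  rw [hinj h, ph_eq_zero hα hb, add_zero]

variable {ord : LinearOrder (Fin n →₀ ℕ)} (hord : IsTermOrder ord)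

lemma ord_antisymm {a b : Fin n →₀ ℕ} (h : ord.le a b) (h' : ord.le b a) : a = b :=
  ord.le_antisymm a b h h'

lemma std_add (hord : IsTermOrder ord) {a c : Fin n →₀ ℕ} (h : Std α ord (a + c)) : Std α ord a := by
  intro b hb
  have h1 := h (b + c) (by rw [map_add, map_add, hb])
  rcases ord.le_total a b with h2 | h2
  · exact h2
  · have h3 := hord.2 _ _ c h2
    have h4 := add_right_cancel (ord_antisymm h1 h3)
    rw [h4]
    exact ord.le_refl b

lemma std_le (hord : IsTermOrder ord) {a b : Fin n →₀ ℕ} (hab : a ≤ b) (h : Std α ord b) :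
    Std α ord a := by
  obtain ⟨c, rfl⟩ := exists_add_of_le hab
  exact std_add hord h

lemma std_unique {a b : Fin n →₀ ℕ} (ha : Std α ord a) (hb : Std α ord b) (h : ph α a = ph α b) :
    a = b :=
  ord_antisymm (ha b h.symm) (hb a h)

lemma exists_std (hα : ∀ i, α i ≠ 0) {μ : M e} (h : μ ∈ sg α) : ∃ a, ph α a = μ ∧ Std α ord a := by
  obtain ⟨a0, h0⟩ := exists_ph h
  obtain ⟨a, ha, hmin⟩ := @Set.exists_min_image _ _ ord {a | ph α a = μ} id (fiber_finite hα μ) ⟨a0, h0⟩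
  refine ⟨a, ha, ?_⟩
  intro b hb
  exact hmin b (hb.trans ha)

section poly
variable (k : Type) [Field k]

lemma aeval_mon (a : Fin n →₀ ℕ) (r : k) :
    MvPolynomial.aeval (R := k)
      (fun i : Fin n => (MvPolynomial.monomial (α i) 1 : MvPolynomial (Fin e) k))
      (MvPolynomial.monomial a r) = MvPolynomial.monomial (ph α a) r := by
  rw [MvPolynomial.aeval_monomial, ph, Finsupp.linearCombination_apply,
    Finsupp.sum, Finsupp.prod]
  simp only [MvPolynomial.monomial_pow, one_pow]
  rw [← MvPolynomial.monomial_sum_one, MvPolynomial.algebraMap_eq, MvPolynomial.C_mul_monomial,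
    mul_one]

lemma lead_not_std {f : MvPolynomial (Fin n) k} (hf : f ∈ toricIdeal k α) {mo : Fin n →₀ ℕ}
    (hmo : mo ∈ f.support) (hle : ∀ m' ∈ f.support, ord.le m' mo) : ¬ Std α ord mo := by
  intro hstd
  rw [toricIdeal, RingHom.mem_ker, MvPolynomial.as_sum f, map_sum] at hf
  simp only [aeval_mon] at hf
  have h1 := congrArg (MvPolynomial.coeff (ph α mo)) hf
  rw [MvPolynomial.coeff_sum, Finset.sum_eq_single mo] at h1
  · rw [MvPolynomial.coeff_monomial, if_pos rfl] at h1
    exact (MvPolynomial.mem_support_iff.1 hmo) (by simpa using h1)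
  · intro b hb hne
    rw [MvPolynomial.coeff_monomial, if_neg]
    intro hph
    exact hne (ord_antisymm (hle b hb) (hstd b hph))
  · intro h; exact absurd hmo h

lemma initial_eq : initialIdeal k ord α = Ideal.span ((fun mo => (MvPolynomial.monomial mo 1 :
    MvPolynomial (Fin n) k)) '' {mo | ∃ f ∈ toricIdeal k α, f ≠ 0 ∧
      (mo ∈ f.support ∧ ∀ m' ∈ f.support, ord.le m' mo)}) := by
  rw [initialIdeal]
  congr 1
  ext p
  constructor
  · rintro ⟨f, hf, h0, mo, h1, rfl⟩
    exact ⟨mo, ⟨f, hf, h0, h1⟩, rfl⟩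
  · rintro ⟨mo, ⟨f, hf, h0, h1⟩, rfl⟩
    exact ⟨f, hf, h0, mo, h1, rfl⟩

lemma mon_mem_iff (hα : ∀ i, α i ≠ 0) (hord : IsTermOrder ord) (a : Fin n →₀ ℕ) :
    (MvPolynomial.monomial a 1 : MvPolynomial (Fin n) k) ∈ initialIdeal k ord α ↔
      ¬ Std α ord a := by
  constructor
  · intro h hstd
    rw [initial_eq, MvPolynomial.mem_ideal_span_monomial_image] at h
    obtain ⟨b, ⟨f, hf, h0, h1, h2⟩, hba⟩ := h a (by
      rw [MvPolynomial.mem_support_iff, MvPolynomial.coeff_monomial, if_pos rfl]; exact one_ne_zero)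
    exact lead_not_std k hf h1 h2 (std_le hord hba hstd)
  · intro h
    obtain ⟨b, hb, hbs⟩ := exists_std (ord := ord) hα (ph_mem (α := α) a)
    have hne : b ≠ a := by rintro rfl; exact h hbs
    refine Ideal.subset_span ⟨MvPolynomial.monomial a 1 - MvPolynomial.monomial b 1, ?_, ?_, a, ⟨?_, ?_⟩, rfl⟩
    · rw [toricIdeal, RingHom.mem_ker, map_sub, aeval_mon, aeval_mon, hb, sub_self]
    · intro h0
      have := congrArg (MvPolynomial.coeff a) h0
      simp [MvPolynomial.coeff_monomial, hne] at this
    · rw [MvPolynomial.mem_support_iff]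
      simp [MvPolynomial.coeff_monomial, hne]
    · intro m hm
      rw [MvPolynomial.mem_support_iff] at hm
      by_cases hma : m = a
      · rw [hma]; exact ord.le_refl a
      by_cases hmb : m = b
      · rw [hmb]; exact hbs a hb.symm
      exact absurd (by simp [MvPolynomial.coeff_monomial, Ne.symm hma, Ne.symm hmb]) hm

lemma quad (hα : ∀ i, α i ≠ 0) (hinj : Function.Injective α)
    (hirr : ∀ i, ¬ ∃ a ∈ sg α, ∃ b ∈ sg α, a ≠ 0 ∧ b ≠ 0 ∧ a + b = α i)
    (hord : IsTermOrder ord) (hGB : HasGB k ord α 2) (a : Fin n →₀ ℕ) (ha : ¬ Std α ord a) :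
    ∃ c d, Finsupp.single c 1 + Finsupp.single d 1 ≤ a ∧
      ¬ Std α ord (Finsupp.single c 1 + Finsupp.single d 1) := by
  obtain ⟨G, hG, hspan⟩ := hGB
  have hmem := (mon_mem_iff k hα hord a).2 ha
  rw [← hspan, MvPolynomial.mem_ideal_span_monomial_image] at hmem
  obtain ⟨g, hgG, hga⟩ := hmem a (by
      rw [MvPolynomial.mem_support_iff, MvPolynomial.coeff_monomial, if_pos rfl]; exact one_ne_zero)
  have hgn : ¬ Std α ord g := by
    rw [← mon_mem_iff k hα hord, ← hspan]
    exact Ideal.subset_span ⟨g, hgG, rfl⟩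
  have hdeg : Finsupp.degree g ≤ 2 := hG g hgG
  have hg0 : g ≠ 0 := by
    rintro rfl
    exact hgn fun b _ => hord.1 b
  obtain ⟨c, hc⟩ := exists_ne hg0
  obtain ⟨g', rfl⟩ := exists_split hc
  have hg0' : g' ≠ 0 := by
    rintro rfl
    apply hgn
    rw [add_zero]
    intro b hb
    rw [ph_single] at hb
    rw [ph_gen hα hinj hirr hb]
    exact ord.le_refl _
  obtain ⟨d, hd⟩ := exists_ne hg0'
  obtain ⟨g'', rfl⟩ := exists_split hd
  have : g'' = 0 := by
    rw [← Finsupp.degree_eq_zero_iff]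
    simp only [map_add, Finsupp.degree_single] at hdeg
    omega
  subst this
  rw [add_zero] at hga hgn
  exact ⟨c, d, hga, hgn⟩

end poly

/-- The normal form data attached to a quadratic Gröbner basis. -/
def mkNF (hα : ∀ i, α i ≠ 0) (hinj : Function.Injective α)
    (hirr : ∀ i, ¬ ∃ a ∈ sg α, ∃ b ∈ sg α, a ≠ 0 ∧ b ≠ 0 ∧ a + b = α i)
    (k : Type) [Field k] (hord : IsTermOrder ord) (hGB : HasGB k ord α 2) : NF α :=
  let nf : M e → (Fin n →₀ ℕ) := fun μ =>
    if h : μ ∈ sg α then (exists_std (ord := ord) hα h).choose else 0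
  have nf1 : ∀ μ ∈ sg α, ph α (nf μ) = μ := by
    intro μ hμ
    simp only [nf, dif_pos hμ]
    exact (exists_std (ord := ord) hα hμ).choose_spec.1
  have nf2 : ∀ μ ∈ sg α, Std α ord (nf μ) := by
    intro μ hμ
    simp only [nf, dif_pos hμ]
    exact (exists_std (ord := ord) hα hμ).choose_spec.2
  have nf3 : ∀ a, Std α ord a → nf (ph α a) = a := fun a ha =>
    std_unique (nf2 _ (ph_mem a)) ha (nf1 _ (ph_mem a))
  have gm : ∀ c, α c ∈ sg α := fun c => AddSubmonoid.subset_closure ⟨c, rfl⟩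
  have ngen : ∀ c, nf (α c) = Finsupp.single c 1 := fun c => ph_gen hα hinj hirr (nf1 _ (gm c))
  { nf := nf
    lt := fun a b => ord.le a b ∧ a ≠ b
    cm := fun c d => Std α ord (Finsupp.single c 1 + Finsupp.single d 1)
    lt_irrefl := fun a h => h.2 rfl
    lt_trans := by
      rintro a b c ⟨h1, h2⟩ ⟨h3, h4⟩
      refine ⟨ord.le_trans _ _ _ h1 h3, ?_⟩
      rintro rfl
      exact h2 (ord_antisymm h1 h3)
    lt_add := fun a b c h => ⟨hord.2 _ _ c h.1, fun hh => h.2 (add_right_cancel hh)⟩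
    nf_gen := ngen
    nf_split := by
      intro μ hμ c hc
      obtain ⟨b, hb⟩ := exists_split hc
      have hs := nf2 μ hμ
      rw [hb] at hs
      have hbs : Std α ord b := by
        rw [add_comm] at hs; exact std_add hord hs
      refine ⟨ph α b, ph_mem b, ?_, ?_, ?_⟩
      · rw [← nf1 μ hμ, hb, map_add, ph_single]
      · rw [nf3 b hbs, hb]
      · intro d hd
        rw [nf3 b hbs] at hd
        obtain ⟨b', rfl⟩ := exists_split hd
        rw [← add_assoc] at hs
        exact std_add hord hs
    nf_join := by
      intro ν hν c hcm
      have hs : Std α ord (Finsupp.single c 1 + nf ν) := by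
        by_contra hns
        obtain ⟨c', d', hle, hns'⟩ := quad k hα hinj hirr hord hGB _ hns
        by_cases h1 : c' = c
        · subst h1
          have h2 : Finsupp.single d' 1 ≤ nf ν := le_of_add_le_add_left hle
          rw [Finsupp.single_le_iff] at h2
          exact hns' (hcm d' (by omega))
        by_cases h2 : d' = c
        · subst h2
          rw [add_comm] at hle hns'
          have h2 : Finsupp.single c' 1 ≤ nf ν := le_of_add_le_add_left hle
          rw [Finsupp.single_le_iff] at h2
          exact hns' (hcm c' (by omega))
        apply hns'
        refine std_le hord ?_ (nf2 ν hν)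
        intro x
        have hx := hle x
        by_cases hxc : x = c
        · subst hxc
          simp [Finsupp.single_apply, h1, h2]
        · simpa [Finsupp.single_apply, Ne.symm hxc] using hx
      have := nf3 _ hs
      rwa [map_add, ph_single, nf1 ν hν] at this
    nf_le := by
      intro μ hμ ν hν
      by_cases h : nf (μ + ν) = nf μ + nf ν
      · exact Or.inl h
      · refine Or.inr ⟨nf2 _ (add_mem hμ hν) _ ?_, h⟩
        rw [map_add, nf1 μ hμ, nf1 ν hν, nf1 _ (add_mem hμ hν)]
    nf_cm := by
      intro c d h
      have := nf2 _ (add_mem (gm c) (gm d))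
      rwa [h, ngen, ngen] at this
    nf_ne := by
      intro μ hμ h0
      apply exists_ne
      intro h
      have := nf1 μ hμ
      rw [h, map_zero] at this
      exact h0 this.symm
    a_ne := hα
    a_inj := hinj
    a_irr := hirr }

end gb
end ASGP
namespace ASGP
open ASG

theorem rational_of_matrix {ι : Type} [Fintype ι] [DecidableEq ι] (A : Matrix ι ι ℤ) (v : ℕ → ι → ℤ)
    (hv : ∀ i, v (i + 1) = A.mulVec (v i)) (j : ι) :
    ∃ p q : Polynomial ℤ, q.coeff 0 = 1 ∧
      (q : PowerSeries ℤ) * PowerSeries.mk (fun i => v i j) = (p : PowerSeries ℤ) := by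
  set Mx : Matrix ι ι (Polynomial ℤ) := 1 - (Polynomial.X : Polynomial ℤ) • A.map Polynomial.C
    with hMx
  let φ : Polynomial ℤ →+* PowerSeries ℤ := Polynomial.coeToPowerSeries.ringHom
  let Fv : ι → PowerSeries ℤ := fun j => PowerSeries.mk (fun i => v i j)
  refine ⟨∑ i, Mx.adjugate j i * Polynomial.C (v 0 i), Mx.det, ?_, ?_⟩
  · have := Matrix.eval_charpolyRev (M := A)
    rw [Polynomial.coeff_zero_eq_eval_zero]
    exact this
  · have h1 : (φ.mapMatrix Mx).mulVec Fv = fun j => φ (Polynomial.C (v 0 j)) := by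
      have hm : φ.mapMatrix Mx = 1 - (PowerSeries.X : PowerSeries ℤ) • A.map PowerSeries.C := by
        ext i j : 2
        simp only [hMx, RingHom.mapMatrix_apply, Matrix.map_apply, Matrix.sub_apply,
          Matrix.smul_apply, map_sub, smul_eq_mul, map_mul]
        congr 1
        · by_cases h : i = j
          · subst h; simp
          · simp [h]
        · simp [φ]
      rw [hm, Matrix.sub_mulVec, Matrix.one_mulVec, Matrix.smul_mulVec]
      funext j
      ext m
      have hφ : φ (Polynomial.C (v 0 j)) = PowerSeries.C (v 0 j) := by simp [φ]
      rw [hφ]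
      simp only [Pi.sub_apply, Pi.smul_apply, smul_eq_mul, map_sub]
      cases m with
      | zero => simp [Fv]
      | succ m =>
        rw [PowerSeries.coeff_succ_X_mul, PowerSeries.coeff_C, if_neg (by omega)]
        simp only [Matrix.mulVec, dotProduct, Matrix.map_apply, map_sum, PowerSeries.coeff_C_mul,
          Fv, PowerSeries.coeff_mk]
        rw [hv m]
        simp [Matrix.mulVec, dotProduct]
    have h2 : (φ Mx.det) • Fv = (φ.mapMatrix Mx).adjugate.mulVec ((φ.mapMatrix Mx).mulVec Fv) := by
      rw [Matrix.mulVec_mulVec, Matrix.adjugate_mul, Matrix.smul_mulVec, Matrix.one_mulVec,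
        RingHom.map_det]
    have h3 := congrFun h2 j
    rw [h1, ← RingHom.map_adjugate] at h3
    have h4 : (∑ i, Mx.adjugate j i * Polynomial.C (v 0 i) : Polynomial ℤ) =
      (φ (∑ i, Mx.adjugate j i * Polynomial.C (v 0 i)) : PowerSeries ℤ) := rfl
    have h5 : (Mx.det : PowerSeries ℤ) * PowerSeries.mk (fun i => v i j) = φ Mx.det * Fv j := rfl
    rw [h5, h4, map_sum]
    simpa [Matrix.mulVec, dotProduct] using h3

lemma finrank_aux {k V W X : Type} [Field k] [AddCommGroup V] [Module k V] [AddCommGroup W]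
    [Module k W] [AddCommGroup X] [Module k X] (R Z : Submodule k V) (f : Z →ₗ[k] W)
    (hf : Function.Surjective f) (hk : ∀ z : Z, f z = 0 ↔ (z : V) ∈ R) :
    Nonempty (W ≃ₗ[k] (Submodule.map R.mkQ Z)) := by
  let g : Z →ₗ[k] (Submodule.map R.mkQ Z) := R.mkQ.submoduleMap Z
  have hg : Function.Surjective g := LinearMap.submoduleMap_surjective _ _
  have hker : LinearMap.ker f = LinearMap.ker g := by
    ext z
    rw [LinearMap.mem_ker, LinearMap.mem_ker, hk]
    rw [← Submodule.coe_eq_zero]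
    simp [g]
  exact ⟨(f.quotKerEquivOfSurjective hf).symm.trans
    ((Submodule.quotEquivOfEq _ _ hker).trans (g.quotKerEquivOfSurjective hg))⟩

namespace NF
variable {e n : ℕ} {α : Fin n → M e} (H : NF α)

def words : ℕ → Finset (Fin n) → Finset (List (Fin n))
  | 0, _ => {[]}
  | i + 1, Q => Q.biUnion fun c => (words i (H.next Q c)).image (List.cons c)

lemma card_words (i : ℕ) (Q : Finset (Fin n)) :
    (H.words (i + 1) Q).card = ∑ c ∈ Q, (H.words i (H.next Q c)).card := by
  rw [words, Finset.card_biUnion]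
  · refine Finset.sum_congr rfl fun c _ => ?_
    exact Finset.card_image_of_injective _ (List.cons_injective)
  · intro c _ d _ hcd
    rw [Function.onFun, Finset.disjoint_left]
    intro w hw hw'
    obtain ⟨u, -, rfl⟩ := Finset.mem_image.1 hw
    obtain ⟨u', -, h⟩ := Finset.mem_image.1 hw'
    exact hcd (List.cons.inj h).1.symm

lemma crit_iff (i : ℕ) : ∀ (Q : Finset (Fin n)) (l : List (M e)), (H.Crit Q l ∧ l.length = i) ↔
    ∃ w ∈ H.words i Q, l = w.map α := by
  induction i with
  | zero =>
    intro Q l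
    simp only [words, Finset.mem_singleton, exists_eq_left, List.map_nil, List.length_eq_zero_iff]
    constructor
    · exact fun h => h.2
    · rintro rfl; exact ⟨Crit.nil Q, rfl⟩
  | succ i ih =>
    intro Q l
    simp only [words, Finset.mem_biUnion, Finset.mem_image]
    constructor
    · rintro ⟨hC, hl⟩
      cases hC with
      | nil => simp at hl
      | cons _ c l hc hC =>
        obtain ⟨w, hw, rfl⟩ := (ih _ l).1 ⟨hC, by simpa using hl⟩
        exact ⟨c :: w, ⟨c, hc, w, hw, rfl⟩, rfl⟩
    · rintro ⟨_, ⟨c, hc, w, hw, rfl⟩, rfl⟩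
      obtain ⟨h1, h2⟩ := (ih (H.next Q c) (w.map α)).2 ⟨w, hw, rfl⟩
      exact ⟨Crit.cons Q c _ hc h1, by simpa using h2⟩

lemma crit_gd {Q : Finset (Fin n)} {l : List (M e)} (h : H.Crit Q l) : Gd α l := by
  induction h with
  | nil => simp [Gd]
  | cons Q c l hc hC ih => exact gd_cons.2 ⟨⟨gen_mem α c, H.a_ne c⟩, ih⟩

theorem words_rational : ∃ p q : Polynomial ℤ, q.coeff 0 = 1 ∧
    (q : PowerSeries ℤ) * PowerSeries.mk (fun i => ((H.words i Finset.univ).card : ℤ)) =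
      (p : PowerSeries ℤ) := by
  refine rational_of_matrix (ι := Finset (Fin n))
    (fun Q Q' => ∑ c ∈ Q, if H.next Q c = Q' then 1 else 0)
    (fun i Q => ((H.words i Q).card : ℤ)) ?_ Finset.univ
  intro i
  funext Q
  rw [card_words]
  simp only [Matrix.mulVec, dotProduct, Finset.sum_mul]
  rw [Finset.sum_comm]
  push_cast
  refine Finset.sum_congr rfl fun c _ => ?_
  simp

section tor
variable (k : Type) [Field k]

def io (α : Fin n → M e) (i : ℕ) : TCt k α i →ₗ[k] (Finset (M e) →₀ k) :=
  Finsupp.lmapDomain k k (fun S : BTFace α i => S.1)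

lemma io_inj (i : ℕ) : Function.Injective (io k α i) :=
  Finsupp.mapDomain_injective Subtype.val_injective

lemma io_comm (i : ℕ) (x : TCt k α i) :
    Finsupp.linearCombination k (bd α k) (io k α i x) = io k α (i - 1) (ttbd k α i x) := by
  suffices h : (Finsupp.linearCombination k (bd α k)) ∘ₗ (io k α i) =
      (io k α (i - 1)) ∘ₗ (ttbd k α i) from LinearMap.congr_fun h x
  refine Finsupp.lhom_ext' fun S => LinearMap.ext_ring ?_
  simp only [LinearMap.comp_apply, Finsupp.lsingle_apply, ttbd, Finsupp.linearCombination_single,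
    one_smul, map_sum]
  rw [io, Finsupp.lmapDomain_apply, Finsupp.mapDomain_single, Finsupp.linearCombination_single,
    one_smul, bd, Finset.sum_filter, ← Finset.sum_attach]
  refine Finset.sum_congr rfl fun v _ => ?_
  by_cases h : v.1 ≠ 0 ∧ ∃ w ∈ S.1, sgLT α v.1 w
  · have h' : Int0 α S.1 v.1 := h
    rw [if_pos h', dif_pos h, map_smul, io, Finsupp.lmapDomain_apply, Finsupp.mapDomain_single]
    rfl
  · have h' : ¬ Int0 α S.1 v.1 := h
    rw [if_neg h', dif_neg h, map_zero]

lemma io_sup (i : ℕ) (x : TCt k α i) : MorseData.Sup (FF α) i (io k α i x) := by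
  intro b hb
  by_contra hne
  apply hb
  refine Finsupp.mapDomain_of_notMem_range _ _ ?_
  rintro ⟨S, rfl⟩
  exact hne S.2

lemma io_ex (i : ℕ) (y : Finset (M e) →₀ k) (hy : MorseData.Sup (FF α) i y) :
    ∃ x, io k α i x = y := by
  have hinj : Function.Injective (fun S : BTFace α i => S.1) := Subtype.val_injective
  refine ⟨Finsupp.comapDomain (fun S : BTFace α i => S.1) y hinj.injOn, ?_⟩
  refine Finsupp.mapDomain_comapDomain _ hinj y ?_
  intro b hb
  exact ⟨⟨b, hy b (by simpa using hb)⟩, rfl⟩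

def jw (α : Fin n → M e) (w : List (Fin n)) : Finset (M e) := ps 0 (w.map α)

lemma jw_gd {e n : ℕ} {α : Fin n → M e} (H : NF α) (w : List (Fin n)) : Gd α (w.map α) := by
  intro m hm
  obtain ⟨c, -, rfl⟩ := List.mem_map.1 hm
  exact ⟨gen_mem α c, H.a_ne c⟩

lemma jw_inj {e n : ℕ} {α : Fin n → M e} (H : NF α) : Function.Injective (jw α) := by
  intro w w' h
  exact List.map_injective_iff.2 H.a_inj (ps_inj (H.jw_gd w) (H.jw_gd w') h)

lemma jw_mem {i : ℕ} {w : List (Fin n)} (hw : w ∈ H.words i Finset.univ) :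
    jw α w ∈ FF α i ∧ jw α w ∈ H.KK := by
  obtain ⟨h1, h2⟩ := (H.crit_iff i Finset.univ (w.map α)).2 ⟨w, hw, rfl⟩
  exact ⟨face_iff.2 ⟨_, H.jw_gd w, h2, rfl⟩, ⟨_, H.jw_gd w, h1, rfl⟩⟩

lemma kk_eq {i : ℕ} {b : Finset (M e)} (hb : b ∈ FF α i) (hK : b ∈ H.KK) :
    ∃ w ∈ H.words i Finset.univ, b = jw α w := by
  obtain ⟨l, hl, hC, rfl⟩ := hK
  obtain ⟨l', hl', h0, h1⟩ := face_iff.1 hb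
  have := ps_inj hl hl' h1
  subst this
  obtain ⟨w, hw, rfl⟩ := (H.crit_iff i Finset.univ l).1 ⟨hC, h0⟩
  exact ⟨w, hw, rfl⟩

theorem tor_equiv {e n : ℕ} {α : Fin n → M e} (H : NF α) (k : Type) [Field k] (i : ℕ) :
    Nonempty ((H.words i Finset.univ → k) ≃ₗ[k] TorTot k α i) := by
  let f0 : TCt k α i →ₗ[k] (H.words i Finset.univ → k) :=
    LinearMap.pi fun w => (Finsupp.lapply (jw α w.1)) ∘ₗ (io k α i)
  have hf0 : ∀ x w, f0 x w = io k α i x (jw α w.1) := fun _ _ => rfl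
  refine finrank_aux (X := k) (LinearMap.range (ttbd k α (i + 1))) (LinearMap.ker (ttbd k α i))
    (f0 ∘ₗ (Submodule.subtype _)) ?_ ?_
  · intro g
    let x : Finset (M e) →₀ k := Finsupp.mapDomain
      (fun w : H.words i Finset.univ => jw α w.1) (Finsupp.equivFunOnFinite.symm g)
    have hinj : Function.Injective (fun w : H.words i Finset.univ => jw α w.1) :=
      H.jw_inj.comp Subtype.val_injective
    have hx : MorseData.Sup (FF α) i x := by
      intro b hb
      by_contra hne
      apply hb
      refine Finsupp.mapDomain_of_notMem_range _ _ ?_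
      rintro ⟨w, rfl⟩
      exact hne (H.jw_mem w.2).1
    obtain ⟨c, hc, hd, hcK⟩ := (H.morse k).homology_surj i x hx
    obtain ⟨c', rfl⟩ := io_ex k i c hc
    refine ⟨⟨c', ?_⟩, ?_⟩
    · rw [LinearMap.mem_ker]
      apply io_inj k (i - 1)
      rw [← io_comm, hd, map_zero]
    · funext w
      change f0 c' w = g w
      rw [hf0, hcK _ (H.jw_mem w.2).2]
      exact Finsupp.mapDomain_apply hinj _ w
  · rintro ⟨z, hz⟩
    change f0 z = 0 ↔ z ∈ LinearMap.range (ttbd k α (i + 1))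
    rw [LinearMap.mem_ker] at hz
    constructor
    · intro h
      obtain ⟨b, hb, hbd⟩ := (H.morse k).homology_inj i (io k α i z) (io_sup k i z)
        (by rw [io_comm, hz, map_zero]) (by
          intro b hb
          by_contra hne
          obtain ⟨w, hw, rfl⟩ := H.kk_eq (io_sup k i z b hne) hb
          exact hne (congrFun h ⟨w, hw⟩))
      obtain ⟨b', rfl⟩ := io_ex k (i + 1) b hb
      refine ⟨b', ?_⟩
      apply io_inj k i
      rw [← hbd, io_comm]
      rfl
    · rintro ⟨b, rfl⟩
      funext w
      rw [hf0]
      have := (H.morse k).dK (io_sup k (i + 1) b) (H.jw_mem w.2).2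
      rw [io_comm] at this
      exact this

theorem main {e n : ℕ} {α : Fin n → M e} (H : NF α) (k : Type) [Field k] : (∀ i : ℕ, FiniteDimensional k (TorTot k α i)) ∧
    ∃ p q : Polynomial ℤ, q.coeff 0 = 1 ∧
      (q : PowerSeries ℤ) *
          PowerSeries.mk (fun i => (Module.finrank k (TorTot k α i) : ℤ)) =
        (p : PowerSeries ℤ) := by
  constructor
  · intro i
    obtain ⟨E⟩ := H.tor_equiv k i
    exact Module.Finite.equiv E
  · have : (fun i => (Module.finrank k (TorTot k α i) : ℤ)) =
        fun i => ((H.words i Finset.univ).card : ℤ) := by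
      funext i
      obtain ⟨E⟩ := H.tor_equiv k i
      rw [← E.finrank_eq]
      simp
    rw [this]
    exact H.words_rational

end tor
end NF
end ASGP
open ASG in
/-- Suppose `I_Λ` has a quadratic Gröbner basis for the field
`k`, the generators are pairwise distinct and each is irreducible in `Λ`.
Then each `Tor_i^{k[Λ]}(k,k)` is finite-dimensional over `k` and the
Poincaré–Betti series `∑ dim_k Tor_i^{k[Λ]}(k,k) · t^i` is rational. -/
theorem poincare_betti_series_rational
    (e n : ℕ) (α : Fin n → M e) (hα : ∀ i, α i ≠ 0) (hinj : Function.Injective α)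
    (hirr : ∀ i, ¬ ∃ a ∈ sg α, ∃ b ∈ sg α, a ≠ 0 ∧ b ≠ 0 ∧ a + b = α i)
    (k : Type) [Field k] (ord : LinearOrder (Fin n →₀ ℕ)) (hord : IsTermOrder ord)
    (hGB : HasGB k ord α 2) :
    (∀ i : ℕ, FiniteDimensional k (TorTot k α i)) ∧
    ∃ p q : Polynomial ℤ, q.coeff 0 = 1 ∧
      (q : PowerSeries ℤ) *
          PowerSeries.mk (fun i => (Module.finrank k (TorTot k α i) : ℤ)) =
        (p : PowerSeries ℤ) := by
  exact (ASGP.mkNF hα hinj hirr k hord hGB).main k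
end
end

section
/- Suppose there exists a ℤ-linear map ℓ : ℤ^e → ℤ with ℓ(α_i) = 1 for all i (so the generators lie on an affine hyperplane and k[Λ] is standard graded with deg x^λ = ℓ(λ)), and suppose that for the field k and some monomial term order the toric ideal I_Λ has a quadratic Gröbner basis (a Gröbner basis of degree 2). Then k[Λ] is Koszul: for every λ ∈ Λ and every integer i ≥ 0 with i ≠ ℓ(λ), the λ-graded component Tor_i^{k[Λ]}(k,k)_λ vanishes. -/
open scoped Classical

noncomputable section

namespace ASG

variable {e n : ℕ}

/-- Faces of the `y`-graded piece of the normalized bar complex of `K` over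
`K[Λ]`, in chain form: finite chains in `Λ` from `0` to `y`.  A basis element
`[x^(μ_1) | ⋯ | x^(μ_i)]` of multidegree `y = μ_1 + ⋯ + μ_i` (all `μ_j ≠ 0`)
corresponds to the chain of partial sums `0 < μ_1 < μ_1 + μ_2 < ⋯ < y`. -/
def IsBFace (α : Fin n → M e) (y : M e) (S : Finset (M e)) : Prop :=
  (∀ μ ∈ S, μ ∈ sg α ∧ sgLE α μ y) ∧ (0 : M e) ∈ S ∧ y ∈ S ∧
    (S : Set (M e)).Pairwise (cmp2 α)

/-- Chains from `0` to `y` with `i + 1` elements, i.e. bar tableaux of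
homological degree `i` and multidegree `y`. -/
def BFace (α : Fin n → M e) (y : M e) (i : ℕ) : Type :=
  { S : Finset (M e) // IsBFace α y S ∧ S.card = i + 1 }

/-- The multidegree-`y` piece of the normalized bar complex of `K` over `K[Λ]`
in homological degree `i`. -/
abbrev TC (K : Type) [Field K] (α : Fin n → M e) (y : M e) (i : ℕ) : Type :=
  BFace α y i →₀ K

/-- Deleting an internal element of a bar chain. -/
def erasedBFace {α : Fin n → M e} {y : M e} {i : ℕ} (S : BFace α y i)
    (v : M e) (hv : v ∈ S.1) (h0 : v ≠ 0) (hy : v ≠ y) : BFace α y (i - 1) :=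
  ⟨S.1.erase v,
    ⟨⟨fun μ hμ => S.2.1.1 μ (Finset.mem_of_mem_erase hμ),
      Finset.mem_erase.2 ⟨fun h => h0 h.symm, S.2.1.2.1⟩,
      Finset.mem_erase.2 ⟨fun h => hy h.symm, S.2.1.2.2.1⟩,
      S.2.1.2.2.2.mono (Finset.coe_subset.mpr (Finset.erase_subset _ _))⟩,
    by
      have h2 : 1 < S.1.card :=
        Finset.one_lt_card.mpr ⟨0, S.2.1.2.1, v, hv, fun h => h0 h.symm⟩
      have hc := S.2.2
      rw [Finset.card_erase_of_mem hv]
      omega⟩⟩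

/-- The differential of the (multidegree-`y` piece of the) normalized bar
complex: merging two adjacent bar entries corresponds to deleting an internal
element of the chain, with sign `(-1)^j` for the `j`-th element of the chain. -/
def tbd (K : Type) [Field K] (α : Fin n → M e) (y : M e) (i : ℕ) :
    TC K α y i →ₗ[K] TC K α y (i - 1) :=
  Finsupp.linearCombination K fun S : BFace α y i =>
    ∑ v ∈ S.1.attach,
      if h : v.1 ≠ 0 ∧ v.1 ≠ y then
        ((-1 : K) ^ (S.1.filter fun w => sgLT α w v.1).card) •
          Finsupp.single (erasedBFace S v.1 v.2 h.1 h.2) 1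
      else 0

/-- Vanishing of `Tor_i^{K[Λ]}(K, K)_y`, computed from the normalized bar
resolution of `K` over `K[Λ]` (which is `Λ`-graded): every cycle of the
multidegree-`y` piece of the bar complex in homological degree `i`
is a boundary. -/
def TorVanishes (K : Type) [Field K] (α : Fin n → M e) (y : M e) (i : ℕ) : Prop :=
  ∀ c : TC K α y i, tbd K α y i c = 0 →
    ∃ b : TC K α y (i + 1), tbd K α y (i + 1) b = c

/-- `Tor_i^{K[Λ]}(K, K)_y`, computed from the normalized bar resolution of `K`
over `K[Λ]`: homology of the multidegree-`y` piece of the bar complex,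
realized as the image of the cycles in the cokernel of the differential. -/
abbrev TorMod (K : Type) [Field K] (α : Fin n → M e) (y : M e) (i : ℕ) : Type :=
  ↥(Submodule.map (Submodule.mkQ (LinearMap.range (tbd K α y (i + 1))))
      (LinearMap.ker (tbd K α y i)))

end ASG

namespace ASG

/-- Abstract algebraic Morse-type vanishing lemma. -/
theorem abs_vanish {k X Y Z P : Type*} [Field k] [Finite Y]
    (d1 : (X →₀ k) →ₗ[k] (Y →₀ k)) (d0 : (Y →₀ k) →ₗ[k] (Z →₀ k))
    (hdd : ∀ x, d0 (d1 x) = 0) (lt : P → P → Prop)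
    (htr : ∀ a b c, lt a b → lt b c → lt a c) (hir : ∀ a, ¬ lt a a)
    (ρ1 ρ2 : Y → P) (Dn : Y → Prop)
    (h1 : ∀ y, ¬ Dn y → ∃ x, d1 (Finsupp.single x 1) y ≠ 0 ∧
      ∀ y', y' ≠ y → d1 (Finsupp.single x 1) y' ≠ 0 → Dn y' ∨ lt (ρ1 y') (ρ1 y))
    (h2 : ∀ y, Dn y → ∃ z, d0 (Finsupp.single y 1) z ≠ 0 ∧
      ∀ y', y' ≠ y → Dn y' → d0 (Finsupp.single y' 1) z ≠ 0 → lt (ρ2 y) (ρ2 y'))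
    (c : Y →₀ k) (hc : d0 c = 0) : ∃ b, d1 b = c := by
  let N : Submodule k (Y →₀ k) := LinearMap.range d1 ⊔ Finsupp.supported k k {y | Dn y}
  have wf : WellFounded (fun a b : Y => lt (ρ1 a) (ρ1 b)) := by
    have : IsTrans Y (fun a b : Y => lt (ρ1 a) (ρ1 b)) := ⟨fun a b c => htr _ _ _⟩
    have : Std.Irrefl (fun a b : Y => lt (ρ1 a) (ρ1 b)) := ⟨fun a => hir _⟩
    exact Finite.wellFounded_of_trans_of_irrefl _
  have wf2 : WellFounded (fun b a : Y => lt (ρ2 a) (ρ2 b)) := by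
    have : IsTrans Y (fun b a : Y => lt (ρ2 a) (ρ2 b)) := ⟨fun a b c h h' => htr _ _ _ h' h⟩
    have : Std.Irrefl (fun b a : Y => lt (ρ2 a) (ρ2 b)) := ⟨fun a => hir _⟩
    exact Finite.wellFounded_of_trans_of_irrefl _
  have key : ∀ y, Finsupp.single y (1 : k) ∈ N := by
    intro y
    induction y using wf.induction with
    | _ y ih =>
      by_cases hy : Dn y
      · exact Submodule.mem_sup_right (Finsupp.single_mem_supported k 1 hy)
      · obtain ⟨x, hx, hx'⟩ := h1 y hy
        set f := d1 (Finsupp.single x 1) with hf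
        have hfN : f ∈ N := Submodule.mem_sup_left ⟨_, rfl⟩
        have hs : f.erase y ∈ N := by
          rw [← Finsupp.sum_single (f.erase y)]
          refine Submodule.sum_mem _ fun y' hy' => ?_
          rw [Finsupp.support_erase, Finset.mem_erase, Finsupp.mem_support_iff] at hy'
          have : Finsupp.single y' (1 : k) ∈ N := by
            rcases hx' y' hy'.1 hy'.2 with h | h
            · exact Submodule.mem_sup_right (Finsupp.single_mem_supported k 1 h)
            · exact ih y' h
          have h3 := N.smul_mem ((f.erase y) y') this
          simpa using h3
        have e : f = Finsupp.single y (f y) + f.erase y := (Finsupp.single_add_erase y f).symm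
        have h4 : Finsupp.single y (f y) ∈ N := by
          have := N.sub_mem hfN hs
          rwa [sub_eq_of_eq_add e] at this
        have h5 := N.smul_mem (f y)⁻¹ h4
        simpa [hx] using h5
  have hcN : c ∈ N := by
    rw [← Finsupp.sum_single c]
    refine Submodule.sum_mem _ fun y' _ => ?_
    have h3 := N.smul_mem (c y') (key y')
    simpa using h3
  obtain ⟨_, ⟨b, rfl⟩, c', hc', e⟩ := Submodule.mem_sup.1 hcN
  refine ⟨b, ?_⟩
  suffices c' = 0 by rw [← e, this, add_zero]
  have hd : d0 c' = 0 := by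
    have := hc
    rw [← e, map_add, hdd, zero_add] at this
    exact this
  by_contra hne
  have hdn : ∀ y, c' y ≠ 0 → Dn y := fun y hy => hc' (Finsupp.mem_support_iff.2 hy)
  have : ({y | c' y ≠ 0} : Set Y).Nonempty := by
    by_contra h
    rw [Set.not_nonempty_iff_eq_empty] at h
    apply hne
    ext y
    by_contra h'
    exact (Set.ext_iff.1 h y).1 h'
  obtain ⟨y, hy, hmin⟩ := wf2.has_min _ this
  obtain ⟨z, hz, hz'⟩ := h2 y (hdn y hy)
  have h0 : d0 c' z = c' y * d0 (Finsupp.single y 1) z := by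
    conv_lhs => rw [← Finsupp.sum_single c']
    rw [Finsupp.sum, map_sum, Finsupp.finsetSum_apply, Finset.sum_eq_single y]
    · have : Finsupp.single y (c' y) = c' y • Finsupp.single y (1 : k) := by simp
      rw [this, map_smul]; rfl
    · intro y' hy' hne'
      have : Finsupp.single y' (c' y') = c' y' • Finsupp.single y' (1 : k) := by simp
      rw [this, map_smul, Finsupp.smul_apply]
      by_cases h : d0 (Finsupp.single y' 1) z = 0
      · rw [h, smul_zero]
      · have hy'' := Finsupp.mem_support_iff.1 hy'
        exact absurd (hz' y' hne' (hdn y' hy'') h) (hmin y' hy'')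
    · intro h
      exact absurd (Finsupp.mem_support_iff.2 hy) h
  rw [hd] at h0
  exact mul_ne_zero hy hz h0.symm

section comb
variable {n : ℕ}

/-- Monomials. -/
abbrev Mo (n : ℕ) : Type := Fin n →₀ ℕ

/-- Next state of the scan. -/
def nx (St : Mo n → Prop) (B : Set (Fin n)) (l : Fin n) : Set (Fin n) :=
  {l' | (l' ∈ B ∧ l' < l) ∨ ¬ St (Finsupp.single l 1 + Finsupp.single l' 1)}

/-- The matching. -/
inductive Mt (St : Mo n → Prop) :
    Set (Fin n) → List (Mo n) → List (Mo n) → List (Fin n) → Prop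
  | here (B : Set (Fin n)) (l : Fin n) (m p q : Mo n) (L : List (Mo n)) (hl : l ∈ B) (hm : m ≠ 0)
      (hp : p = Finsupp.single l 1 + m) (hq : q = Finsupp.single l 1)
      (hs : St p) (hmin : ∀ l' ∈ B, m l' ≠ 0 → l ≤ l') : Mt St B (p :: L) (q :: m :: L) [l]
  | cons (B : Set (Fin n)) (l : Fin n) (q : Mo n) (U D : List (Mo n)) (w : List (Fin n))
      (hl : l ∈ B) (hq : q = Finsupp.single l 1)
      (h : Mt St (nx St B l) U D w) : Mt St B (q :: U) (q :: D) (l :: w)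

/-- Merging of adjacent entries. -/
inductive Mrg (nf : Mo n → Mo n) : List (Mo n) → List (Mo n) → Prop
  | here (p q r : Mo n) (L : List (Mo n)) (hr : r = nf (p + q)) : Mrg nf (p :: q :: L) (r :: L)
  | cons (p : Mo n) (D V : List (Mo n)) (h : Mrg nf D V) : Mrg nf (p :: D) (p :: V)

/-- Word order: lexicographic, longer is smaller. -/
inductive Wl : List (Fin n) → List (Fin n) → Prop
  | ext (a : Fin n) (w : List (Fin n)) : Wl (a :: w) []
  | lex (a b : Fin n) (w w' : List (Fin n)) (h : a < b) : Wl (a :: w) (b :: w')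
  | cons (a : Fin n) (w w' : List (Fin n)) (h : Wl w w') : Wl (a :: w) (a :: w')

theorem Wl.irr (w : List (Fin n)) : ¬ Wl w w := by
  induction w with
  | nil => intro h; cases h
  | cons a w ih =>
    intro h
    cases h with
    | lex _ _ _ _ h => exact lt_irrefl _ h
    | cons _ _ _ h => exact ih h

theorem Wl.tr {a b c : List (Fin n)} (h : Wl a b) (h' : Wl b c) : Wl a c := by
  induction h generalizing c with
  | ext a w => cases h'
  | lex a b w w' h =>
    cases h' with
    | ext => exact .ext _ _
    | lex _ _ _ _ h2 => exact .lex _ _ _ _ (h.trans h2)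
    | cons _ _ _ h2 => exact .lex _ _ _ _ h
  | cons a w w' h ih =>
    cases h' with
    | ext => exact .ext _ _
    | lex _ _ _ _ h2 => exact .lex _ _ _ _ h2
    | cons _ _ _ h2 => exact .cons _ _ _ (ih h2)

theorem single_ne_add {a b : Fin n} {m : Mo n} (hm : m ≠ 0)
    (h : Finsupp.single a 1 = Finsupp.single b 1 + m) : False := by
  have := congrArg Finsupp.degree h
  rw [map_add, Finsupp.degree_single, Finsupp.degree_single] at this
  have h0 : m.degree = 0 := by omega
  exact hm ((Finsupp.degree_eq_zero_iff m).1 h0)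

theorem single_inj {a b : Fin n} (h : Finsupp.single a 1 = Finsupp.single b 1) : a = b := by
  exact (Finsupp.single_left_injective (one_ne_zero : (1:ℕ) ≠ 0)) h

theorem Mt.unique {St : Mo n → Prop} {B : Set (Fin n)} {U D D' : List (Mo n)} {w w' : List (Fin n)}
    (h : Mt St B U D w) (h' : Mt St B U D' w') : D = D' ∧ w = w' := by
  induction h generalizing D' w' with
  | here B l m p q L hl hm hp hq hs hmin =>
    cases h' with
    | here _ l' m' _ q' _ hl' hm' hp' hq' hs' hmin' =>
      have e : Finsupp.single l 1 + m = Finsupp.single l' 1 + m' := hp ▸ hp'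
      have hll : l = l' := by
        by_contra hne
        have a1 : m l' ≠ 0 := by
          have := DFunLike.congr_fun e l'
          simp [Finsupp.single_apply, hne] at this
          omega
        have a2 : m' l ≠ 0 := by
          have := DFunLike.congr_fun e l
          simp [Finsupp.single_apply, Ne.symm hne] at this
          omega
        exact hne (le_antisymm (hmin _ hl' a1) (hmin' _ hl a2))
      subst hll
      have : m = m' := add_left_cancel e
      subst this hq hq'
      simp
    | cons _ l' q' _ D1 w1 hl' hq' h1 =>
      exact (single_ne_add hm (hq' ▸ hp)).elim
  | cons B l q U D w hl hq h ih =>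
    cases h' with
    | here _ l' m' _ q' _ hl' hm' hp' hq' hs' hmin' =>
      exact (single_ne_add hm' (hq ▸ hp')).elim
    | cons _ l' q' _ D1 w1 hl' hq' h1 =>
      have : l = l' := single_inj (hq ▸ hq')
      subst this
      obtain ⟨rfl, rfl⟩ := ih h1
      simp

theorem Mt.ne_nil {St : Mo n → Prop} {B : Set (Fin n)} {U D : List (Mo n)} {w : List (Fin n)}
    (h : Mt St B U D w) : w ≠ [] := by
  cases h <;> simp

theorem Mt.length {St : Mo n → Prop} {B : Set (Fin n)} {U D : List (Mo n)} {w : List (Fin n)}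
    (h : Mt St B U D w) : D.length = U.length + 1 := by
  induction h with
  | here => simp
  | cons _ _ _ _ _ _ _ _ _ ih => simp [ih]

theorem Mt.sum {St : Mo n → Prop} {B : Set (Fin n)} {U D : List (Mo n)} {w : List (Fin n)}
    (h : Mt St B U D w) : D.sum = U.sum := by
  induction h with
  | here B l m p q L hl hm hp hq hs hmin => simp [hp, hq, add_assoc]
  | cons _ _ _ _ _ _ _ _ _ ih => simp [ih]

theorem Mt.mrg {St : Mo n → Prop} {nf : Mo n → Mo n} (hnf : ∀ m, St m → nf m = m)
    {B : Set (Fin n)} {U D : List (Mo n)} {w : List (Fin n)}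
    (h : Mt St B U D w) : Mrg nf D U := by
  induction h with
  | here B l m p q L hl hm hp hq hs hmin =>
    exact .here _ _ _ _ (by rw [hq, ← hp, hnf _ hs])
  | cons _ _ _ _ _ _ _ _ _ ih => exact .cons _ _ _ ih

/-- Valid lists. -/
def VL (St : Mo n → Prop) (L : List (Mo n)) : Prop := ∀ m ∈ L, St m ∧ m ≠ 0

theorem Mt.validD {St : Mo n → Prop} (hdiv : ∀ a b, St (a + b) → St a)
    {B : Set (Fin n)} {U D : List (Mo n)} {w : List (Fin n)}
    (h : Mt St B U D w) (hU : VL St U) : VL St D := by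
  induction h with
  | here B l m p q L hl hm hp hq hs hmin =>
    intro x hx
    simp only [List.mem_cons] at hx
    rcases hx with rfl | rfl | hx
    · refine ⟨hdiv _ m (by rw [hq, ← hp]; exact hs), ?_⟩
      rw [hq]; simp
    · refine ⟨hdiv x (Finsupp.single l 1) (by rw [add_comm, ← hp]; exact hs), hm⟩
    · exact hU x (List.mem_cons_of_mem _ hx)
  | cons B l q U D w hl hq h ih =>
    intro x hx
    rcases List.mem_cons.1 hx with rfl | hx
    · exact hU _ List.mem_cons_self
    · exact ih (fun y hy => hU y (List.mem_cons_of_mem _ hy)) x hx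

theorem Mt.validU {St : Mo n → Prop}
    {B : Set (Fin n)} {U D : List (Mo n)} {w : List (Fin n)}
    (h : Mt St B U D w) (hU : VL St D) : VL St U := by
  induction h with
  | here B l m p q L hl hm hp hq hs hmin =>
    intro x hx
    rcases List.mem_cons.1 hx with rfl | hx
    · refine ⟨hs, fun h0 => hm ?_⟩
      rw [hp] at h0
      exact (add_eq_zero.1 h0).2
    · exact hU x (by simp [hx])
  | cons B l q U D w hl hq h ih =>
    intro x hx
    rcases List.mem_cons.1 hx with rfl | hx
    · exact hU _ List.mem_cons_self
    · exact ih (fun y hy => hU y (List.mem_cons_of_mem _ hy)) x hx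

/-- Sum under merging. -/
theorem Mrg.sum {St : Mo n → Prop} {nf : Mo n → Mo n} {lt : Mo n → Mo n → Prop}
    (hnf : ∀ m, St m → nf m = m) (hnf' : ∀ m, ¬ St m → lt (nf m) m)
    (hadd : ∀ a b c, lt a b → lt (a + c) (b + c))
    {D V : List (Mo n)} (h : Mrg nf D V) : V.sum = D.sum ∨ lt V.sum D.sum := by
  induction h with
  | here p q r L hr =>
    by_cases hs : St (p + q)
    · left; simp [hr, hnf _ hs, add_assoc]
    · right
      have := hadd _ _ L.sum (hnf' _ hs)
      simpa [hr, add_assoc] using this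
  | cons p D V h ih =>
    rcases ih with h | h
    · left; simp [h]
    · right
      have := hadd _ _ p h
      simpa [add_comm] using this

/-- Key lemma: triangularity. -/
theorem Mt.key {St : Mo n → Prop} {nf : Mo n → Mo n} {lt : Mo n → Mo n → Prop}
    (hnf : ∀ m, St m → nf m = m) (hnf' : ∀ m, ¬ St m → lt (nf m) m)
    (hadd : ∀ a b c, lt a b → lt (a + c) (b + c))
    {B : Set (Fin n)} {U D V D' : List (Mo n)} {w w' : List (Fin n)}
    (h : Mt St B U D w) (hV : Mrg nf D V) (h' : Mt St B V D' w') :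
    V = U ∨ lt V.sum D.sum ∨ Wl w' w := by
  induction h generalizing V D' w' with
  | here B l m p q L hl hm hp hq hs hmin =>
    cases hV with
    | here _ _ r _ hr =>
      left
      rw [hr, hq, ← hp, hnf _ hs]
    | cons _ _ V1 h1 =>
      right; right
      cases h' with
      | here _ l' m' _ q' _ hl' hm' hp' hq' hs' hmin' =>
        exact (single_ne_add hm' (hq ▸ hp')).elim
      | cons _ l' q' _ D1 w1 hl' hq' h1 =>
        have : l = l' := single_inj (hq ▸ hq')
        subst this
        obtain ⟨x, y, rfl⟩ := List.exists_cons_of_ne_nil h1.ne_nil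
        exact .cons _ _ _ (.ext _ _)
  | cons B l q U D w hl hq h ih =>
    cases hV with
    | here _ q2 r L hr =>
      have hq2 : ∃ l2 ∈ nx St B l, q2 = Finsupp.single l2 1 := by
        cases h with
        | here _ l2 m p q L hl hm hp hq hs hmin => exact ⟨l2, hl, hq⟩
        | cons B l2 q U D w hl hq h => exact ⟨l2, hl, hq⟩
      obtain ⟨l2, hl2, rfl⟩ := hq2
      right
      by_cases hs : St (q + Finsupp.single l2 1)
      · right
        rw [hnf _ hs] at hr
        have hl3 : l2 ∈ B ∧ l2 < l := by
          rcases hl2 with h | h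
          · exact h
          · rw [hq] at hs; exact absurd hs h
        cases h' with
        | here _ a m' _ q' _ hl' hm' hp' hq' hs' hmin' =>
          apply Wl.lex
          by_cases hal : a = l2
          · rw [hal]; exact hl3.2
          · have : m' l2 ≠ 0 := by
              have e := DFunLike.congr_fun (hr.symm.trans hp') l2
              simp [Finsupp.single_apply, hal] at e
              omega
            exact lt_of_le_of_lt (hmin' _ hl3.1 this) hl3.2
        | cons _ a q' _ D1 w1 hl' hq' h1 =>
          rw [hq'] at hr
          rw [hq] at hr
          exact (single_ne_add (by simp) hr).elim
      · left
        have := hadd _ _ L.sum (hnf' _ hs)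
        simpa [hr, add_assoc] using this
    | cons _ _ V1 h1 =>
      cases h' with
      | here _ l' m' _ q' _ hl' hm' hp' hq' hs' hmin' =>
        exact (single_ne_add hm' (hq ▸ hp')).elim
      | cons _ l' q' _ D1 w1 hl' hq' h2 =>
        have : l = l' := single_inj (hq ▸ hq')
        subst this
        rcases ih h1 h2 with h | h | h
        · left; rw [h]
        · right; left
          have := hadd _ _ q h
          simpa [add_comm] using this
        · right; right; exact .cons _ _ _ h

theorem Mt.exists {St : Mo n → Prop}
    (hpair : ∀ (l : Fin n) (m : Mo n), St (Finsupp.single l 1) → St m →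
      (∀ l', m l' ≠ 0 → St (Finsupp.single l 1 + Finsupp.single l' 1)) →
      St (Finsupp.single l 1 + m))
    (L : List (Mo n)) (hL : VL St L) (B : Set (Fin n))
    (hB : ∀ m ∈ L.head?, ∃ l ∈ B, m l ≠ 0) :
    (∃ D w, Mt St B L D w) ∨ (∃ U w, Mt St B U L w) ∨ (∀ m ∈ L, m.degree = 1) := by
  induction L generalizing B with
  | nil => right; right; simp
  | cons m L ih =>
    have hne : ({l | l ∈ B ∧ m l ≠ 0} : Set (Fin n)).Nonempty := by
      obtain ⟨l, h, h'⟩ := hB m (by simp)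
      exact ⟨l, h, h'⟩
    obtain ⟨l, ⟨hlB, hml⟩, hmin⟩ := (wellFounded_lt (α := Fin n)).has_min _ hne
    have hmin' : ∀ l' ∈ B, m l' ≠ 0 → l ≤ l' := fun l' h1 h2 => not_lt.1 (hmin l' ⟨h1, h2⟩)
    have hle : Finsupp.single l 1 ≤ m := by
      rw [Finsupp.single_le_iff]; omega
    obtain ⟨m', rfl⟩ := exists_add_of_le hle
    by_cases hm' : m' = 0
    · subst hm'
      simp only [add_zero] at *
      have hL1 : VL St L := fun x hx => hL x (List.mem_cons_of_mem _ hx)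
      by_cases hB' : ∀ m ∈ L.head?, ∃ l' ∈ nx St B l, m l' ≠ 0
      · rcases ih hL1 _ hB' with ⟨D, w, h⟩ | ⟨U, w, h⟩ | h
        · left; exact ⟨_, _, .cons _ _ _ _ _ _ hlB rfl h⟩
        · right; left; exact ⟨_, _, .cons _ _ _ _ _ _ hlB rfl h⟩
        · right; right
          intro x hx
          rcases List.mem_cons.1 hx with rfl | hx
          · simp
          · exact h x hx
      · right; left
        push Not at hB'
        obtain ⟨m2, hm2, hno⟩ := hB'
        cases L with
        | nil => simp at hm2
        | cons m3 L2 =>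
          simp only [List.head?_cons, Option.mem_def, Option.some.injEq] at hm2
          subst hm2
          have hno' : ∀ l', m3 l' ≠ 0 → l' ∉ nx St B l := fun l' h h' => h (hno l' h')
          refine ⟨_, _, .here _ l m3 _ _ L2 hlB (hL1 m3 (by simp)).2 rfl rfl ?_ ?_⟩
          · refine hpair l m3 (hL _ (by simp)).1 (hL1 m3 (by simp)).1 fun l' hl' => ?_
            by_contra hc
            exact hno' l' hl' (Or.inr hc)
          · intro l' h1 h2
            by_contra hc
            exact hno' l' h2 (Or.inl ⟨h1, not_le.1 hc⟩)
    · left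
      refine ⟨_, _, .here _ l m' _ _ L hlB hm' rfl rfl (hL _ (by simp)).1 fun l' h1 h2 => ?_⟩
      exact hmin' l' h1 (by simp only [Finsupp.add_apply]; omega)

end comb
end ASG

namespace ASG

section bdry
variable {e n : ℕ} (K : Type) [Field K] (α : Fin n → M e) (y : M e)

/-- Position of an element in a chain. -/
def pos (S : Finset (M e)) (v : M e) : ℕ := (S.filter fun w => sgLT α w v).card

/-- Interior elements. -/
def inner (S : Finset (M e)) : Finset (M e) := S.filter fun v => v ≠ 0 ∧ v ≠ y

/-- Boundary map on formal sums of finsets. -/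
def bd : (Finset (M e) →₀ K) →ₗ[K] (Finset (M e) →₀ K) :=
  Finsupp.linearCombination K fun S : Finset (M e) =>
    ∑ v ∈ inner y S, ((-1 : K) ^ pos α S v) • Finsupp.single (S.erase v) 1

/-- Forget that something is a face. -/
def inc (i : ℕ) : TC K α y i →ₗ[K] (Finset (M e) →₀ K) :=
  Finsupp.lmapDomain K K fun S : BFace α y i => S.1

theorem inc_single (i : ℕ) (S : BFace α y i) (c : K) :
    inc K α y i (Finsupp.single S c) = Finsupp.single S.1 c := by
  simp [inc]

theorem inc_injective (i : ℕ) : Function.Injective (inc K α y i) :=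
  Finsupp.mapDomain_injective Subtype.val_injective

theorem inc_apply (i : ℕ) (c : TC K α y i) (S : BFace α y i) : inc K α y i c S.1 = c S :=
  Finsupp.mapDomain_apply (f := fun S : BFace α y i => S.1) Subtype.val_injective c S

theorem inc_tbd (i : ℕ) (c : TC K α y i) :
    inc K α y (i - 1) (tbd K α y i c) = bd K α y (inc K α y i c) := by
  induction c using Finsupp.induction_linear with
  | zero => simp
  | add f g hf hg => simp only [map_add, hf, hg]
  | single S c =>
    rw [inc_single]
    simp only [tbd, bd, Finsupp.linearCombination_single, map_smul, map_sum]
    congr 1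
    rw [inner, Finset.sum_filter]
    conv_rhs => rw [← Finset.sum_attach]
    refine Finset.sum_congr rfl fun v _ => ?_
    split_ifs with h
    · rw [map_smul, inc_single]; rfl
    · simp

theorem sgLT_asymm {a b : M e} (h : sgLT α a b) (h' : sgLT α b a) : False := by
  obtain ⟨⟨d, _, h1⟩, h2⟩ := h
  obtain ⟨⟨d', _, h3⟩, _⟩ := h'
  apply h2
  apply le_antisymm
  · rw [← h1]; exact le_self_add
  · rw [← h3]; exact le_self_add

theorem bd_bd_aux {S : Finset (M e)} {v w : M e} (hw : w ∈ S) (h : sgLT α w v) :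
    ((-1 : K) ^ pos α S v * (-1 : K) ^ pos α (S.erase v) w)
      + ((-1 : K) ^ pos α S w * (-1 : K) ^ pos α (S.erase w) v) = 0 := by
  have h1 : pos α (S.erase v) w = pos α S w := by
    unfold pos
    congr 1
    ext x
    simp only [Finset.mem_filter, Finset.mem_erase]
    constructor
    · rintro ⟨⟨_, a⟩, b⟩; exact ⟨a, b⟩
    · rintro ⟨a, b⟩
      refine ⟨⟨?_, a⟩, b⟩
      rintro rfl
      exact sgLT_asymm α h b
  have h2 : pos α S v = pos α (S.erase w) v + 1 := by
    unfold pos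
    rw [Finset.filter_erase, Finset.card_erase_add_one]
    exact Finset.mem_filter.2 ⟨hw, h⟩
  rw [h1, h2]
  ring

theorem bd_bd {S : Finset (M e)} (hS : (S : Set (M e)).Pairwise (cmp2 α)) (c : K) :
    bd K α y (bd K α y (Finsupp.single S c)) = 0 := by
  simp only [bd, Finsupp.linearCombination_single, map_smul, map_sum, one_smul]
  rw [smul_eq_zero]
  right
  have hin : ∀ v, inner y (S.erase v) = (inner y S).erase v := by
    intro v
    unfold inner
    rw [Finset.filter_erase]
  simp only [hin, Finset.smul_sum, smul_smul]
  rw [Finset.sum_sigma']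
  refine Finset.sum_involution (fun p _ => ⟨p.2, p.1⟩) ?_ ?_ ?_ ?_
  · rintro ⟨v, w⟩ hp
    simp only [Finset.mem_sigma, Finset.mem_erase] at hp
    obtain ⟨hv, hne, hw⟩ := hp
    have hvS : v ∈ S := (Finset.mem_filter.1 hv).1
    have hwS : w ∈ S := (Finset.mem_filter.1 hw).1
    simp only
    rw [Finset.erase_right_comm, ← add_smul]
    have : ((-1 : K) ^ pos α S v * (-1 : K) ^ pos α (S.erase v) w)
      + ((-1 : K) ^ pos α S w * (-1 : K) ^ pos α (S.erase w) v) = 0 := by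
      rcases hS hvS hwS (Ne.symm hne) with h | h
      · rw [add_comm]; exact bd_bd_aux K α hvS ⟨h, Ne.symm hne⟩
      · exact bd_bd_aux K α hwS ⟨h, hne⟩
    rw [this, zero_smul]
  · rintro ⟨v, w⟩ hp _ heq
    simp only [Finset.mem_sigma, Finset.mem_erase] at hp
    simp only [Sigma.mk.injEq, heq_eq_eq] at heq
    exact hp.2.1 heq.1
  · rintro ⟨v, w⟩ hp
    simp only [Finset.mem_sigma, Finset.mem_erase] at hp ⊢
    exact ⟨hp.2.2, Ne.symm hp.2.1, hp.1⟩
  · rintro ⟨v, w⟩ _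
    rfl

theorem tbd_tbd (i : ℕ) (c : TC K α y (i + 1)) : tbd K α y i (tbd K α y (i + 1) c) = 0 := by
  apply inc_injective
  rw [map_zero, inc_tbd]
  have h := inc_tbd K α y (i + 1) c
  refine (congrArg (bd K α y) h).trans ?_
  clear h
  induction c using Finsupp.induction_linear with
  | zero => simp
  | add f g hf hg =>
    simp only [map_add]
    rw [hf, hg, add_zero]
  | single S c =>
    rw [inc_single]
    exact bd_bd K α y S.2.1.2.2.2 c

theorem bd_apply_ne {S T : Finset (M e)} (h : bd K α y (Finsupp.single S 1) T ≠ 0) :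
    ∃ v ∈ S, v ≠ 0 ∧ v ≠ y ∧ T = S.erase v := by
  simp only [bd, Finsupp.linearCombination_single, one_smul, Finsupp.finsetSum_apply] at h
  obtain ⟨v, hv, hne⟩ := Finset.exists_ne_zero_of_sum_ne_zero h
  obtain ⟨h1, h2, h3⟩ := Finset.mem_filter.1 hv
  refine ⟨v, h1, h2, h3, ?_⟩
  by_contra hc
  apply hne
  simp [Finsupp.single_apply, Ne.symm hc]

theorem bd_apply_erase {S : Finset (M e)} {v : M e} (hv : v ∈ S) (h0 : v ≠ 0) (hy : v ≠ y) :
    bd K α y (Finsupp.single S 1) (S.erase v) ≠ 0 := by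
  simp only [bd, Finsupp.linearCombination_single, one_smul, Finsupp.finsetSum_apply]
  rw [Finset.sum_eq_single v]
  · simp
  · intro w hw hne
    have hw' : w ∈ S := (Finset.mem_filter.1 hw).1
    have : S.erase w ≠ S.erase v := by
      intro h
      have h1 : w ∈ S.erase v := Finset.mem_erase.2 ⟨hne, hw'⟩
      rw [← h] at h1
      exact Finset.notMem_erase _ _ h1
    simp [Finsupp.single_apply, this]
  · intro h
    exact absurd (Finset.mem_filter.2 ⟨hv, h0, hy⟩) h

instance finite_BFace (i : ℕ) : Finite (BFace α y i) := by
  have hfin : (Set.Iic y).Finite := Set.finite_Iic y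
  let f : BFace α y i → ↥(hfin.toFinset.powerset) := fun S => ⟨S.1, by
    rw [Finset.mem_powerset]
    intro x hx
    obtain ⟨d, _, h⟩ := (S.2.1.1 x hx).2
    rw [Set.Finite.mem_toFinset, Set.mem_Iic, ← h]
    exact le_self_add⟩
  refine Finite.of_injective f fun a b h => ?_
  exact Subtype.ext (Subtype.mk.inj h)

end bdry
end ASG

namespace ASG

section groeb
variable {e n : ℕ}

/-- The monoid map `ℕ^n → ℕ^e`. -/
def phi (α : Fin n → M e) : (Fin n →₀ ℕ) →ₗ[ℕ] M e := Finsupp.linearCombination ℕ α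

theorem mem_sg {α : Fin n → M e} {x : M e} : x ∈ sg α ↔ ∃ m, phi α m = x := by
  constructor
  · intro h
    induction h using AddSubmonoid.closure_induction with
    | mem x hx =>
      obtain ⟨i, rfl⟩ := hx
      exact ⟨Finsupp.single i 1, by simp [phi]⟩
    | zero => exact ⟨0, map_zero _⟩
    | add x y _ _ hx hy =>
      obtain ⟨a, rfl⟩ := hx
      obtain ⟨b, rfl⟩ := hy
      exact ⟨a + b, map_add _ _ _⟩
  · rintro ⟨m, rfl⟩
    induction m using Finsupp.induction_linear with
    | zero => simp
    | add f g hf hg => rw [map_add]; exact add_mem hf hg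
    | single i c =>
      simp only [phi, Finsupp.linearCombination_single]
      exact nsmul_mem (AddSubmonoid.subset_closure (Set.mem_range_self i)) c

theorem degree_phi {α : Fin n → M e} {l : (Fin e → ℤ) →ₗ[ℤ] ℤ}
    (hl : ∀ i, l (fun j => ((α i) j : ℤ)) = 1) (m : Fin n →₀ ℕ) :
    l (fun j => ((phi α m) j : ℤ)) = m.degree := by
  induction m using Finsupp.induction_linear with
  | zero =>
    have : (fun j => (((phi α 0) j : ℕ) : ℤ)) = 0 := by ext j; simp
    rw [this]; simp
  | add f g hf hg =>
    have : (fun j => (((phi α (f + g)) j : ℕ) : ℤ)) =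
      (fun j => (((phi α f) j : ℕ) : ℤ)) + (fun j => (((phi α g) j : ℕ) : ℤ)) := by ext j; simp
    rw [this, map_add, hf, hg, map_add]; simp
  | single i c =>
    have : (fun j => (((phi α (Finsupp.single i c)) j : ℕ) : ℤ)) =
      (c : ℤ) • (fun j => (((α i) j : ℕ) : ℤ)) := by ext j; simp [phi]
    rw [this, map_smul, hl]; simp

/-- Standard monomials. -/
def Stm (ord : LinearOrder (Fin n →₀ ℕ)) (α : Fin n → M e) (m : Fin n →₀ ℕ) : Prop :=
  ∀ m', phi α m' = phi α m → ord.le m m'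

/-- strict term order. -/
def tlt (ord : LinearOrder (Fin n →₀ ℕ)) (a b : Fin n →₀ ℕ) : Prop := ord.le a b ∧ a ≠ b

variable {ord : LinearOrder (Fin n →₀ ℕ)} {α : Fin n → M e}

theorem tlt_trans (a b c : Fin n →₀ ℕ) (h : tlt ord a b) (h' : tlt ord b c) : tlt ord a c := by
  refine ⟨ord.le_trans _ _ _ h.1 h'.1, ?_⟩
  rintro rfl
  exact h.2 (ord.le_antisymm _ _ h.1 h'.1)

theorem tlt_add (hord : IsTermOrder ord) (a b c : Fin n →₀ ℕ) (h : tlt ord a b) :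
    tlt ord (a + c) (b + c) :=
  ⟨hord.2 _ _ _ h.1, fun h' => h.2 (add_right_cancel h')⟩

theorem not_stm {m : Fin n →₀ ℕ} (h : ¬ Stm ord α m) : ∃ m', phi α m' = phi α m ∧ tlt ord m' m := by
  obtain ⟨m', h⟩ := not_forall.1 h
  obtain ⟨h1, h2⟩ := Classical.not_imp.1 h
  refine ⟨m', h1, (ord.le_total m m').resolve_left h2, ?_⟩
  rintro rfl
  exact h2 (ord.le_refl _)

theorem stm_add (hord : IsTermOrder ord) (a b : Fin n →₀ ℕ) (h : Stm ord α (a + b)) :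
    Stm ord α a := by
  by_contra hc
  obtain ⟨m', h1, h2⟩ := not_stm hc
  have h3 := tlt_add hord _ _ b h2
  exact h3.2 (ord.le_antisymm _ _ h3.1 (h _ (by rw [map_add, map_add, h1])))

theorem stm_inj {a b : Fin n →₀ ℕ} (ha : Stm ord α a) (hb : Stm ord α b)
    (h : phi α a = phi α b) : a = b :=
  ord.le_antisymm _ _ (ha _ h.symm) (hb _ h)

theorem exists_stm {l : (Fin e → ℤ) →ₗ[ℤ] ℤ}
    (hl : ∀ i, l (fun j => ((α i) j : ℤ)) = 1) (m : Fin n →₀ ℕ) :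
    ∃ m', phi α m' = phi α m ∧ Stm ord α m' := by
  have hfin : {m' : Fin n →₀ ℕ | phi α m' = phi α m}.Finite := by
    have hsub : {m' : Fin n →₀ ℕ | phi α m' = phi α m} ⊆
        {m' : Fin n →₀ ℕ | m' ≤ Finsupp.equivFunOnFinite.symm fun _ => m.degree} := by
      intro m' hm' j
      have h1 := degree_phi hl m'
      have h2 := degree_phi hl m
      rw [hm', h2] at h1
      have h3 : m.degree = m'.degree := by exact_mod_cast h1
      simp only [Finsupp.equivFunOnFinite_symm_apply_apply]
      rw [h3]
      exact Finsupp.le_degree j m'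
    exact (Set.finite_Iic _).subset hsub
  obtain ⟨m', hm', hmin⟩ := @Set.exists_min_image _ _ ord _ id hfin ⟨m, rfl⟩
  exact ⟨m', hm', fun m'' h => hmin m'' (h.trans hm')⟩

theorem aeval_mon (k : Type) [Field k] (m : Fin n →₀ ℕ) (c : k) :
    MvPolynomial.aeval (R := k)
      (fun i : Fin n => (MvPolynomial.monomial (α i) 1 : MvPolynomial (Fin e) k))
      (MvPolynomial.monomial m c) = MvPolynomial.monomial (phi α m) c := by
  induction m using Finsupp.induction_linear generalizing c with
  | zero => simp
  | add f g hf hg =>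
    have : (MvPolynomial.monomial (f + g) c : MvPolynomial (Fin n) k) =
      MvPolynomial.monomial f c * MvPolynomial.monomial g 1 := by
        rw [MvPolynomial.monomial_mul, mul_one]
    rw [this, map_mul, hf, hg, MvPolynomial.monomial_mul, mul_one, map_add]
  | single i d =>
    rw [MvPolynomial.aeval_monomial]
    simp [phi, MvPolynomial.monomial_pow, MvPolynomial.C_mul_monomial]

theorem nonstd_mem (k : Type) [Field k] {m : Fin n →₀ ℕ} (h : ¬ Stm ord α m) :
    (MvPolynomial.monomial m 1 : MvPolynomial (Fin n) k) ∈ initialIdeal k ord α := by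
  obtain ⟨m', h1, h2⟩ := not_stm h
  apply Ideal.subset_span
  have hcm : MvPolynomial.coeff m
      (MvPolynomial.monomial m 1 - MvPolynomial.monomial m' 1 : MvPolynomial (Fin n) k) = 1 := by
    simp [MvPolynomial.coeff_monomial, h2.2]
  have hms : m ∈ (MvPolynomial.monomial m 1 -
      MvPolynomial.monomial m' 1 : MvPolynomial (Fin n) k).support := by
    rw [MvPolynomial.mem_support_iff, hcm]; exact one_ne_zero
  refine ⟨MvPolynomial.monomial m 1 - MvPolynomial.monomial m' 1, ?_, ?_, m, ⟨hms, ?_⟩, rfl⟩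
  · rw [toricIdeal, RingHom.mem_ker, map_sub, aeval_mon, aeval_mon, h1, sub_self]
  · intro h0
    rw [h0] at hcm
    simp at hcm
  · intro x hx
    rw [MvPolynomial.mem_support_iff] at hx
    by_cases hxm : m = x
    · rw [hxm]; exact ord.le_refl _
    · by_cases hxm' : m' = x
      · rw [← hxm']; exact h2.1
      · simp [MvPolynomial.coeff_monomial, hxm, hxm'] at hx

theorem lead_nonstd (k : Type) [Field k] {f : MvPolynomial (Fin n) k} (hf : f ∈ toricIdeal k α)
    {mo : Fin n →₀ ℕ} (hmo : mo ∈ f.support) (hmax : ∀ m' ∈ f.support, ord.le m' mo) :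
    ¬ Stm ord α mo := by
  intro hst
  rw [toricIdeal, RingHom.mem_ker] at hf
  have h1 := congrArg (MvPolynomial.coeff (phi α mo)) hf
  conv_lhs at h1 => rw [MvPolynomial.as_sum f, map_sum, MvPolynomial.coeff_sum]
  rw [Finset.sum_eq_single mo] at h1
  · rw [aeval_mon, MvPolynomial.coeff_monomial, if_pos rfl] at h1
    exact MvPolynomial.mem_support_iff.1 hmo (by simpa using h1)
  · intro b hb hne
    rw [aeval_mon, MvPolynomial.coeff_monomial, if_neg]
    intro hh
    exact hne (ord.le_antisymm _ _ (hmax b hb) (hst b hh))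
  · intro h; exact absurd hmo h

theorem mem_nonstd (hord : IsTermOrder ord) (k : Type) [Field k] {g : Fin n →₀ ℕ}
    (h : (MvPolynomial.monomial g 1 : MvPolynomial (Fin n) k) ∈ initialIdeal k ord α) :
    ¬ Stm ord α g := by
  have hset : initialIdeal k ord α = Ideal.span
      ((fun s => (MvPolynomial.monomial s 1 : MvPolynomial (Fin n) k)) '' {m | ¬ Stm ord α m}) := by
    apply le_antisymm
    · apply Ideal.span_le.2
      rintro p ⟨f, hf, _, mo, ⟨hmo, hmax⟩, rfl⟩
      exact Ideal.subset_span ⟨mo, lead_nonstd k hf hmo hmax, rfl⟩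
    · apply Ideal.span_le.2
      rintro p ⟨m, hm, rfl⟩
      exact nonstd_mem k hm
  rw [hset, MvPolynomial.mem_ideal_span_monomial_image] at h
  obtain ⟨s, hs, hle⟩ := h g (by simp)
  intro hg
  obtain ⟨c, rfl⟩ := exists_add_of_le hle
  exact hs (stm_add hord _ _ hg)

theorem pair_crit (hord : IsTermOrder ord) (k : Type) [Field k] (hGB : HasGB k ord α 2)
    (l : Fin n) (m : Fin n →₀ ℕ) (hl : Stm ord α (Finsupp.single l 1)) (hm : Stm ord α m)
    (hp : ∀ l', m l' ≠ 0 → Stm ord α (Finsupp.single l 1 + Finsupp.single l' 1)) :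
    Stm ord α (Finsupp.single l 1 + m) := by
  by_contra hc
  obtain ⟨G, hG, hspan⟩ := hGB
  have h1 := nonstd_mem k hc
  rw [← hspan, MvPolynomial.mem_ideal_span_monomial_image] at h1
  obtain ⟨g, hg, hle⟩ := h1 (Finsupp.single l 1 + m) (by simp)
  have hgn : ¬ Stm ord α g := by
    apply mem_nonstd hord k
    rw [← hspan]
    exact Ideal.subset_span ⟨g, hg, rfl⟩
  have hdeg : g.degree ≤ 2 := hG g hg
  by_cases hgl : g l = 0
  · apply hgn
    have : g ≤ m := by
      intro j
      by_cases hj : j = l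
      · rw [hj, hgl]; exact Nat.zero_le _
      · have := hle j
        simpa [Finsupp.single_apply, Ne.symm hj] using this
    obtain ⟨c, rfl⟩ := exists_add_of_le this
    exact stm_add hord _ _ hm
  · have h2 : Finsupp.single l 1 ≤ g := by rw [Finsupp.single_le_iff]; omega
    obtain ⟨g', rfl⟩ := exists_add_of_le h2
    have hg' : g' ≤ m := by
      intro j
      have := hle j
      simp only [Finsupp.add_apply] at this
      omega
    by_cases h0 : g' = 0
    · rw [h0, add_zero] at hgn; exact hgn hl
    · obtain ⟨l', hl'⟩ := Finsupp.ne_iff.1 h0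
      have h3 : Finsupp.single l' 1 ≤ g' := by
        rw [Finsupp.single_le_iff]; simp at hl'; omega
      obtain ⟨g'', rfl⟩ := exists_add_of_le h3
      have h4 : g''.degree = 0 := by
        simp only [map_add, Finsupp.degree_single] at hdeg
        omega
      rw [(Finsupp.degree_eq_zero_iff g'').1 h4, add_zero] at hgn
      apply hgn
      apply hp
      have := hg' l'
      simp at this
      omega

end groeb
end ASG

namespace ASG

section chains
variable {e n : ℕ} (α : Fin n → M e)

/-- The chain of partial sums of a list of monomials. -/
def ps : M e → List (Mo n) → Finset (M e)
  | s, [] => {s}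
  | s, m :: L => insert s (ps (s + phi α m) L)

variable {α}

theorem self_mem_ps (s : M e) (L : List (Mo n)) : s ∈ ps α s L := by
  cases L <;> simp [ps]

theorem end_mem_ps (s : M e) (L : List (Mo n)) : s + phi α L.sum ∈ ps α s L := by
  induction L generalizing s with
  | nil => simp [ps]
  | cons m L ih =>
    have := ih (s + phi α m)
    rw [ps, List.sum_cons, map_add, ← add_assoc]
    exact Finset.mem_insert_of_mem this

theorem ps_below {s x : M e} {L : List (Mo n)} (h : x ∈ ps α s L) : ∃ m, s + phi α m = x := by
  induction L generalizing s with
  | nil => exact ⟨0, by simp [ps] at h; simp [h]⟩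
  | cons m L ih =>
    rcases Finset.mem_insert.1 h with rfl | h
    · exact ⟨0, by simp⟩
    · obtain ⟨m', h'⟩ := ih h
      exact ⟨m + m', by rw [map_add, ← add_assoc, h']⟩

theorem ps_above {s x : M e} {L : List (Mo n)} (h : x ∈ ps α s L) :
    ∃ m, x + phi α m = s + phi α L.sum := by
  induction L generalizing s with
  | nil => exact ⟨0, by simp [ps] at h; simp [h]⟩
  | cons m L ih =>
    rcases Finset.mem_insert.1 h with rfl | h
    · exact ⟨_, rfl⟩
    · obtain ⟨m', h'⟩ := ih h
      exact ⟨m', by rw [h', List.sum_cons, map_add, ← add_assoc]⟩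

theorem ps_cmp {s x x' : M e} {L : List (Mo n)} (h : x ∈ ps α s L) (h' : x' ∈ ps α s L) :
    cmp2 α x x' := by
  induction L generalizing s with
  | nil =>
    simp [ps] at h h'
    subst h h'
    exact Or.inl ⟨0, zero_mem _, by simp⟩
  | cons m L ih =>
    rcases Finset.mem_insert.1 h with rfl | h1
    · obtain ⟨d, hd⟩ := ps_below h'
      exact Or.inl ⟨_, mem_sg.2 ⟨d, rfl⟩, hd⟩
    · rcases Finset.mem_insert.1 h' with rfl | h2
      · obtain ⟨d, hd⟩ := ps_below h
        exact Or.inr ⟨_, mem_sg.2 ⟨d, rfl⟩, hd⟩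
      · exact ih h1 h2

theorem ps_le {s x : M e} {L : List (Mo n)} (h : x ∈ ps α s L) : s ≤ x := by
  obtain ⟨m, rfl⟩ := ps_below h
  exact le_self_add

theorem notMem_ps (h0 : ∀ m, phi α m = 0 → m = 0) {s : M e} {m : Mo n} (hm : m ≠ 0)
    {L : List (Mo n)} : s ∉ ps α (s + phi α m) L := by
  intro h
  have h1 := ps_le h
  have h2 : s + phi α m = s := le_antisymm h1 le_self_add
  exact hm (h0 _ (by simpa using h2))

variable {St : Mo n → Prop}

theorem VL.tail {m : Mo n} {L : List (Mo n)} (h : VL St (m :: L)) : VL St L :=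
  fun x hx => h x (List.mem_cons_of_mem _ hx)

theorem ps_card (h0 : ∀ m, phi α m = 0 → m = 0) (s : M e) {L : List (Mo n)} (hL : VL St L) :
    (ps α s L).card = L.length + 1 := by
  induction L generalizing s with
  | nil => simp [ps]
  | cons m L ih =>
    rw [ps, Finset.card_insert_of_notMem (notMem_ps h0 (hL m (by simp)).2), ih _ hL.tail,
      List.length_cons]

theorem ps_inj (h0 : ∀ m, phi α m = 0 → m = 0)
    (hinj : ∀ a b, St a → St b → phi α a = phi α b → a = b)
    (s : M e) {L L' : List (Mo n)} (hL : VL St L) (hL' : VL St L')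
    (h : ps α s L = ps α s L') : L = L' := by
  induction L generalizing s L' with
  | nil =>
    have h1 := congrArg Finset.card h
    rw [ps_card h0 s hL, ps_card h0 s hL'] at h1
    simp at h1
    exact h1.symm
  | cons m L ih =>
    cases L' with
    | nil =>
      have h1 := congrArg Finset.card h
      rw [ps_card h0 s hL, ps_card h0 s hL'] at h1
      simp at h1
    | cons m' L' =>
      have hm := hL m (by simp)
      have hm' := hL' m' (by simp)
      have h1 := congrArg (fun S => Finset.erase S s) h
      simp only [ps] at h1
      rw [Finset.erase_insert (notMem_ps h0 hm.2), Finset.erase_insert (notMem_ps h0 hm'.2)] at h1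
      have h2 : s + phi α m' ≤ s + phi α m := ps_le (h1 ▸ self_mem_ps _ _)
      have h3 : s + phi α m ≤ s + phi α m' := ps_le (h1.symm ▸ self_mem_ps _ _)
      have h4 : s + phi α m = s + phi α m' := le_antisymm h3 h2
      have h5 : m = m' := hinj _ _ hm.1 hm'.1 (add_left_cancel h4)
      subst h5
      rw [ih _ hL.tail hL'.tail h1]

theorem ps_exists (hex : ∀ m, ∃ m', phi α m' = phi α m ∧ St m') (N : ℕ) (S : Finset (M e))
    (hN : S.card = N) (s y : M e) (hs : s ∈ S) (hy : y ∈ S)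
    (hmin : ∀ x ∈ S, sgLE α s x) (hmax : ∀ x ∈ S, sgLE α x y)
    (hc : (S : Set (M e)).Pairwise (cmp2 α)) :
    ∃ L, VL St L ∧ ps α s L = S ∧ s + phi α L.sum = y := by
  have hle : ∀ {a b : M e}, sgLE α a b → a ≤ b := by
    rintro a b ⟨d, _, rfl⟩; exact le_self_add
  induction N generalizing S s with
  | zero => rw [Finset.card_eq_zero] at hN; simp [hN] at hs
  | succ N ih =>
    by_cases hne : (S.erase s).Nonempty
    · obtain ⟨s', hs'⟩ := Finset.exists_minimal hne
      have hs'S := Finset.mem_erase.1 hs'.1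
      obtain ⟨d, hd, hd'⟩ := hmin s' hs'S.2
      obtain ⟨m0, hm0⟩ := mem_sg.1 hd
      obtain ⟨m, hm, hst⟩ := hex m0
      have hsm : s + phi α m = s' := by rw [hm, hm0, hd']
      have hm_ne : m ≠ 0 := by
        rintro rfl
        apply hs'S.1
        rw [← hsm]; simp
      obtain ⟨L, hL, hps, hsum⟩ := ih (S.erase s) (by rw [Finset.card_erase_of_mem hs, hN]; rfl)
        s' hs'.1 (by
          refine Finset.mem_erase.2 ⟨?_, hy⟩
          rintro rfl
          exact hs'S.1 (le_antisymm (hle (hmax _ hs'S.2)) (hle (hmin _ hs'S.2))))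
        (by
          intro x hx
          by_cases hxs : x = s'
          · subst hxs; exact ⟨0, zero_mem _, by simp⟩
          · rcases hc (Finset.mem_coe.2 hs'S.2) (Finset.mem_coe.2 (Finset.mem_erase.1 hx).2)
              (Ne.symm hxs) with h | h
            · exact h
            · exact absurd (le_antisymm (hle h) (hs'.2 hx (hle h))) hxs)
        (fun x hx => hmax x (Finset.mem_erase.1 hx).2)
        (hc.mono (Finset.coe_subset.mpr (Finset.erase_subset _ _)))
      refine ⟨m :: L, ?_, ?_, ?_⟩
      · intro x hx
        rcases List.mem_cons.1 hx with rfl | hx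
        · exact ⟨hst, hm_ne⟩
        · exact hL x hx
      · rw [ps, hsm, hps, Finset.insert_erase hs]
      · rw [List.sum_cons, map_add, ← add_assoc, hsm, hsum]
    · rw [Finset.not_nonempty_iff_eq_empty] at hne
      have hS : S = {s} := by
        rw [← Finset.insert_erase hs, hne]; rfl
      refine ⟨[], by intro x hx; simp at hx, by rw [ps, hS], ?_⟩
      rw [hS, Finset.mem_singleton] at hy
      simp [hy]

theorem erase_mrg (h0 : ∀ m, phi α m = 0 → m = 0) {nf : Mo n → Mo n}
    (hnf : ∀ m, phi α (nf m) = phi α m) {s v : M e} {D : List (Mo n)} (hD : VL St D)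
    (hv : v ∈ ps α s D) (hvs : v ≠ s) (hve : v ≠ s + phi α D.sum) :
    ∃ V, Mrg nf D V ∧ ps α s V = (ps α s D).erase v := by
  induction D generalizing s with
  | nil => simp [ps] at hv; exact absurd hv hvs
  | cons m L ih =>
    have hm := (hD m (by simp)).2
    have hv' := (Finset.mem_insert.1 hv).resolve_left hvs
    by_cases hvm : v = s + phi α m
    · cases L with
      | nil => exact absurd (by simpa using hvm) hve
      | cons m2 L2 =>
        refine ⟨_, .here m m2 _ L2 rfl, ?_⟩
        have hm2 := (hD m2 (by simp)).2
        rw [ps, ps, ps, hnf, map_add, ← add_assoc, hvm, Finset.erase_insert_of_ne (hvm ▸ hvs.symm),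
          Finset.erase_insert (notMem_ps h0 hm2)]
    · obtain ⟨V, hV, hps⟩ := ih (s := s + phi α m) hD.tail hv' hvm (by
        rw [List.sum_cons, map_add, ← add_assoc] at hve; exact hve)
      refine ⟨_, .cons m _ _ hV, ?_⟩
      rw [ps, ps, hps, Finset.erase_insert_of_ne hvs.symm]

theorem mrg_erase (h0 : ∀ m, phi α m = 0 → m = 0) {nf : Mo n → Mo n}
    (hnf : ∀ m, phi α (nf m) = phi α m) {s : M e} {D V : List (Mo n)} (hD : VL St D)
    (h : Mrg nf D V) :
    ∃ v ∈ ps α s D, v ≠ s ∧ v ≠ s + phi α D.sum ∧ ps α s V = (ps α s D).erase v := by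
  have hlt : ∀ {s : M e} {m : Mo n}, m ≠ 0 → s ≠ s + phi α m := by
    intro s m hm h
    exact hm (h0 _ (by simpa using h.symm))
  induction h generalizing s with
  | here m m2 r L hr =>
    have hm := (hD m (by simp)).2
    have hm2 := (hD m2 (by simp)).2
    refine ⟨s + phi α m, ?_, (hlt hm).symm, ?_, ?_⟩
    · rw [ps]; exact Finset.mem_insert_of_mem (self_mem_ps _ _)
    · rw [List.sum_cons, map_add, ← add_assoc]
      apply hlt
      rw [List.sum_cons]
      intro h
      exact hm2 (add_eq_zero.1 h).1
    · rw [ps, ps, ps, hr, hnf, map_add, ← add_assoc, Finset.erase_insert_of_ne (hlt hm),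
          Finset.erase_insert (notMem_ps h0 hm2)]
  | cons m D V h ih =>
    have hm := (hD m (by simp)).2
    obtain ⟨v, hv, h1, h2, h3⟩ := ih (s := s + phi α m) hD.tail
    have hvs : v ≠ s := by
      rintro rfl
      exact notMem_ps h0 hm hv
    refine ⟨v, Finset.mem_insert_of_mem hv, hvs, ?_, ?_⟩
    · rw [List.sum_cons, map_add, ← add_assoc]; exact h2
    · rw [ps, ps, h3, Finset.erase_insert_of_ne hvs.symm]

theorem mrg_valid (h0 : ∀ m, phi α m = 0 → m = 0) {nf : Mo n → Mo n}
    (hnf : ∀ m, phi α (nf m) = phi α m) (hst : ∀ m, St (nf m)) {D V : List (Mo n)}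
    (hD : VL St D) (h : Mrg nf D V) : VL St V := by
  induction h with
  | here m m2 r L hr =>
    intro x hx
    rcases List.mem_cons.1 hx with rfl | hx
    · refine ⟨hr ▸ hst _, fun hx0 => ?_⟩
      have h1 := hnf (m + m2)
      rw [← hr, hx0, map_zero] at h1
      exact (hD m (by simp)).2 (add_eq_zero.1 (h0 _ h1.symm)).1
    · exact hD x (by simp [hx])
  | cons m D V h ih =>
    intro x hx
    rcases List.mem_cons.1 hx with rfl | hx
    · exact hD _ (by simp)
    · exact ih hD.tail x hx

theorem ps_isBFace {y : M e} {L : List (Mo n)} (hsum : phi α L.sum = y) :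
    IsBFace α y (ps α 0 L) := by
  refine ⟨fun μ hμ => ⟨?_, ?_⟩, self_mem_ps _ _, ?_, fun a ha b hb _ => ps_cmp ha hb⟩
  · obtain ⟨m, rfl⟩ := ps_below hμ
    rw [zero_add]; exact mem_sg.2 ⟨m, rfl⟩
  · obtain ⟨m, hm⟩ := ps_above hμ
    exact ⟨_, mem_sg.2 ⟨m, rfl⟩, by rw [hm, zero_add, hsum]⟩
  · have := end_mem_ps (α := α) 0 L
    rwa [zero_add, hsum] at this

theorem BFace_list (hex : ∀ m, ∃ m', phi α m' = phi α m ∧ St m') {y : M e} {j : ℕ}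
    (S : BFace α y j) : ∃ L, VL St L ∧ ps α 0 L = S.1 ∧ phi α L.sum = y := by
  obtain ⟨L, h1, h2, h3⟩ := ps_exists (St := St) hex _ S.1 rfl 0 y S.2.1.2.1 S.2.1.2.2.1
    (fun x hx => ⟨x, (S.2.1.1 x hx).1, zero_add x⟩) (fun x hx => (S.2.1.1 x hx).2) S.2.1.2.2.2
  exact ⟨L, h1, h2, by rwa [zero_add] at h3⟩

end chains

end ASG
open ASG in
/-- Suppose the generators lie on an affine hyperplane
(there is a `ℤ`-linear `ℓ : ℤ^e → ℤ` with `ℓ(α_i) = 1` for all `i`, so `k[Λ]`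
is standard graded with `deg x^λ = ℓ(λ)`), and `I_Λ` has a quadratic Gröbner
basis for the field `k`.  Then `k[Λ]` is Koszul:
`Tor_i^{k[Λ]}(k,k)_λ = 0` whenever `i ≠ ℓ(λ)`. -/
theorem quadratic_groebner_koszul
    (e n : ℕ) (α : Fin n → M e) (hα : ∀ i, α i ≠ 0)
    (l : (Fin e → ℤ) →ₗ[ℤ] ℤ) (hl : ∀ i, l (fun j => ((α i) j : ℤ)) = 1)
    (k : Type) [Field k] (ord : LinearOrder (Fin n →₀ ℕ)) (hord : IsTermOrder ord)
    (hGB : HasGB k ord α 2)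
    (lam : M e) (hlam : lam ∈ sg α) (i : ℕ)
    (hi : (i : ℤ) ≠ l (fun j => (lam j : ℤ))) :
    TorVanishes k α lam i := by
  have hdeg := degree_phi hl
  have h0 : ∀ m, phi α m = 0 → m = 0 := by
    intro m hm
    have h1 := hdeg m
    rw [hm] at h1
    have h2 : (fun j => (((0 : M e) j : ℕ) : ℤ)) = 0 := by ext j; simp
    rw [h2, map_zero] at h1
    exact (Finsupp.degree_eq_zero_iff m).1 (by exact_mod_cast h1.symm)
  have hex : ∀ m, ∃ m', phi α m' = phi α m ∧ Stm ord α m' := exists_stm hl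
  choose nf hnfphi hnfst using hex
  have hinj : ∀ a b, Stm ord α a → Stm ord α b → phi α a = phi α b → a = b :=
    fun a b ha hb h => stm_inj ha hb h
  have hnf : ∀ m, Stm ord α m → nf m = m := fun m hm => hinj _ _ (hnfst m) hm (hnfphi m)
  have hnf' : ∀ m, ¬ Stm ord α m → tlt ord (nf m) m := by
    intro m hm
    refine ⟨hnfst m m (hnfphi m).symm, fun h => hm ?_⟩
    rw [← h]; exact hnfst m
  have hadd := tlt_add hord
  have hlist : ∀ (j : ℕ) (S : BFace α lam j),
      ∃ L, VL (Stm ord α) L ∧ ps α 0 L = S.1 ∧ phi α L.sum = lam :=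
    fun j S => BFace_list (fun m => ⟨nf m, hnfphi m, hnfst m⟩) S
  choose lst lst_valid lst_ps lst_sum using hlist
  have lst_len : ∀ j S, (lst j S).length = j := by
    intro j S
    have h1 := ps_card h0 0 (lst_valid j S)
    rw [lst_ps, S.2.2] at h1
    omega
  have lst_inj : ∀ j S T, lst j S = lst j T → S = T := by
    intro j S T h
    apply Subtype.ext
    rw [← lst_ps, ← lst_ps, h]
  have mk : ∀ (j : ℕ) (L : List (Mo n)), VL (Stm ord α) L → L.length = j → phi α L.sum = lam →
      ∃ S : BFace α lam j, lst j S = L := by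
    intro j L hL hlen hsum
    let S : BFace α lam j := ⟨ps α 0 L, ps_isBFace hsum, by rw [ps_card h0 0 hL, hlen]⟩
    exact ⟨S, ps_inj h0 hinj 0 (lst_valid j S) hL (lst_ps j S)⟩
  have coef : ∀ (j : ℕ) (S : BFace α lam j) (T : BFace α lam (j - 1)),
      tbd k α lam j (Finsupp.single S 1) T ≠ 0 ↔ Mrg nf (lst j S) (lst (j - 1) T) := by
    intro j S T
    rw [← inc_apply, inc_tbd, inc_single]
    constructor
    · intro h
      obtain ⟨v, hv, hv0, hvy, hT⟩ := bd_apply_ne k α lam h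
      rw [← lst_ps] at hv
      obtain ⟨V, hV, hps⟩ := erase_mrg h0 hnfphi (lst_valid j S) hv hv0
        (by rw [zero_add, lst_sum]; exact hvy)
      have hVv : VL (Stm ord α) V := mrg_valid h0 hnfphi hnfst (lst_valid j S) hV
      have : V = lst (j - 1) T := by
        apply ps_inj h0 hinj 0 hVv (lst_valid _ T)
        rw [hps, lst_ps, lst_ps, hT]
      rwa [← this]
    · intro h
      obtain ⟨v, hv, hv0, hvy, hT⟩ := mrg_erase (s := 0) h0 hnfphi (lst_valid j S) h
      rw [zero_add, lst_sum] at hvy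
      rw [lst_ps, lst_ps] at hT
      rw [lst_ps] at hv
      rw [hT]
      exact bd_apply_erase k α lam hv hv0 hvy
  have tri : ∀ S : BFace α lam i, (∃ D w, Mt (Stm ord α) Set.univ (lst i S) D w) ∨
      (∃ U w, Mt (Stm ord α) Set.univ U (lst i S) w) := by
    intro S
    rcases Mt.exists (pair_crit hord k hGB) (lst i S) (lst_valid i S) Set.univ (by
      intro m hm
      have := (lst_valid i S m (List.mem_of_mem_head? hm)).2
      obtain ⟨l, hl⟩ := Finsupp.ne_iff.1 this
      exact ⟨l, Set.mem_univ _, hl⟩) with h | h | h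
    · exact Or.inl h
    · exact Or.inr h
    · exfalso
      apply hi
      have h1 := hdeg (lst i S).sum
      rw [lst_sum] at h1
      rw [h1]
      have h2 : ∀ L : List (Mo n), (∀ m ∈ L, m.degree = 1) → L.sum.degree = L.length := by
        intro L
        induction L with
        | nil => simp
        | cons a L ih =>
          intro h
          rw [List.sum_cons, map_add, h a (by simp), ih (fun m hm => h m (by simp [hm])),
            List.length_cons, add_comm]
      rw [h2 _ h, lst_len]
  let wd : List (Mo n) → List (Fin n) := fun U =>
    if h : ∃ w, ∃ D, Mt (Stm ord α) Set.univ U D w then h.choose else []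
  have hwd : ∀ {U D w}, Mt (Stm ord α) Set.univ U D w → wd U = w := by
    intro U D w h
    have hx : ∃ w, ∃ D, Mt (Stm ord α) Set.univ U D w := ⟨w, D, h⟩
    have h1 : wd U = hx.choose := dif_pos hx
    obtain ⟨D', h2⟩ := hx.choose_spec
    rw [h1, (h.unique h2).2]
  let rlt : List (Mo n) → List (Mo n) → Prop := fun U V =>
    tlt ord U.sum V.sum ∨ (U.sum = V.sum ∧ Wl (wd U) (wd V))
  have rtr : ∀ a b c, rlt a b → rlt b c → rlt a c := by
    rintro a b c (h | ⟨h, h'⟩) (g | ⟨g, g'⟩)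
    · exact Or.inl (tlt_trans _ _ _ h g)
    · exact Or.inl (g ▸ h)
    · exact Or.inl (h ▸ g)
    · exact Or.inr ⟨h.trans g, h'.tr g'⟩
  have rir : ∀ a, ¬ rlt a a := by
    rintro a (h | ⟨_, h⟩)
    · exact h.2 rfl
    · exact Wl.irr _ h
  have key : ∀ {U D V D' w w'}, Mt (Stm ord α) Set.univ U D w → Mrg nf D V →
      Mt (Stm ord α) Set.univ V D' w' → V ≠ U → rlt V U := by
    intro U D V D' w w' h hm h' hne
    rcases h.key hnf hnf' hadd hm h' with h1 | h1 | h1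
    · exact absurd h1 hne
    · left; rw [← h.sum]; exact h1
    · rcases hm.sum hnf hnf' hadd with h2 | h2
      · right
        rw [← h.sum, hwd h, hwd h']
        exact ⟨h2, h1⟩
      · left; rw [← h.sum]; exact h2
  let Dn : BFace α lam i → Prop := fun S => ∃ U, ∃ w, Mt (Stm ord α) Set.univ U (lst i S) w
  let Up : BFace α lam i → List (Mo n) := fun S => if h : Dn S then h.choose else []
  have hUp : ∀ S, Dn S → ∃ w, Mt (Stm ord α) Set.univ (Up S) (lst i S) w := by
    intro S h
    have : Up S = h.choose := dif_pos h
    rw [this]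
    exact h.choose_spec
  intro c hc
  refine abs_vanish (X := BFace α lam (i + 1)) (Y := BFace α lam i) (Z := BFace α lam (i - 1))
    (tbd k α lam (i + 1)) (tbd k α lam i) (tbd_tbd k α lam i) rlt rtr rir (lst i) Up Dn
    ?_ ?_ c hc
  · intro y hy
    obtain ⟨D, w, h⟩ := (tri y).resolve_right hy
    obtain ⟨x, hx⟩ := mk (i + 1) D (h.validD (stm_add hord) (lst_valid i y))
      (by rw [h.length, lst_len]) (by rw [h.sum, lst_sum])
    refine ⟨x, ?_, ?_⟩
    · refine (coef (i + 1) x y).2 ?_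
      rw [hx]
      exact h.mrg hnf
    · intro y' hne hcoef
      have hm := (coef (i + 1) x y').1 hcoef
      rw [hx] at hm
      rcases tri y' with ⟨D', w', h'⟩ | h'
      · right
        exact key h hm h' fun h2 => hne (lst_inj i _ _ h2)
      · left; exact h'
  · intro y hy
    obtain ⟨w, h⟩ := hUp y hy
    obtain ⟨z, hz⟩ := mk (i - 1) (Up y) (h.validU (lst_valid i y))
      (by have := h.length; rw [lst_len] at this; omega) (by rw [← h.sum, lst_sum])
    refine ⟨z, ?_, ?_⟩
    · rw [coef, hz]
      exact h.mrg hnf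
    · intro y' hne hy' hcoef
      rw [coef, hz] at hcoef
      obtain ⟨w', h'⟩ := hUp y' hy'
      refine key h' hcoef h fun h2 => hne ?_
      rw [h2] at h
      exact lst_inj i _ _ (h'.unique h).1
end
end
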